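/- Well-posedness for the multiplicative kernel: Let ν₀ be a positive Radon measure on (0,∞) with m₂(0) = ∫ x² ν₀(dx) < ∞. Then Smoluchowski's coagulation equation with kernel K=xy has exactly one measure-valued solution (in the weak sense below) with initial data ν₀ on the time interval [0, m₂(0)^{−1}). -/

import Mathlib

/-!
Well-posedness of Smoluchowski's coagulation equation with multiplicative kernel
K = xy on the time interval [0, m₂(0)⁻¹) before gelation (Menon–Pego, Theorem 2.15).
-/

open MeasureTheory Filter Topology Set Real

noncomputable section

/-- Membership in E₂ ⊂ C²(Ē): twice continuously differentiable on (0,∞), with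
f, f′, f″ having finite limits at 0 and ∞, f(0⁺) = f′(0⁺) = 0, and
|f′| + |f″| decaying exponentially. -/
def MemE2 (f : ℝ → ℝ) : Prop :=
  (∀ x : ℝ, 0 < x → HasDerivAt f (deriv f x) x) ∧
  (∀ x : ℝ, 0 < x → HasDerivAt (deriv f) (deriv (deriv f) x) x) ∧
  ContinuousOn f (Set.Ioi 0) ∧
  ContinuousOn (deriv f) (Set.Ioi 0) ∧
  ContinuousOn (deriv (deriv f)) (Set.Ioi 0) ∧
  Tendsto f (𝓝[>] (0:ℝ)) (𝓝 0) ∧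
  Tendsto (deriv f) (𝓝[>] (0:ℝ)) (𝓝 0) ∧
  (∃ a : ℝ, Tendsto (deriv (deriv f)) (𝓝[>] (0:ℝ)) (𝓝 a)) ∧
  (∃ b : ℝ, Tendsto f atTop (𝓝 b)) ∧
  (∃ b' : ℝ, Tendsto (deriv f) atTop (𝓝 b')) ∧
  (∃ b'' : ℝ, Tendsto (deriv (deriv f)) atTop (𝓝 b'')) ∧
  (∃ C α : ℝ, 0 < α ∧
    ∀ x : ℝ, 0 < x → |deriv f x| + |deriv (deriv f) x| ≤ C * Real.exp (-α * x))

/-- The coagulation pairing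
`⟨f, L(ν)⟩ = ½ ∫∫ [f(x+y) − f(x) − f(y)] K(x,y) ν(dx) ν(dy)`. -/
def coagPairing (K : ℝ → ℝ → ℝ) (ν : Measure ℝ) (f : ℝ → ℝ) : ℝ :=
  (1/2) * ∫ p in (Set.Ioi (0:ℝ)) ×ˢ (Set.Ioi (0:ℝ)),
    (f (p.1 + p.2) - f p.1 - f p.2) * K p.1 p.2 ∂(ν.prod ν)

/-- The second moment m₂(ν) = ∫ x² ν(dx) ∈ [0,∞]. -/
def secondMoment (ν : Measure ℝ) : ENNReal :=
  ∫⁻ x in Set.Ioi (0:ℝ), ENNReal.ofReal (x ^ 2) ∂ν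

/-- Measure-valued weak solution of Smoluchowski's coagulation equation with
multiplicative kernel K = xy (homogeneity degree γ = 2), initial data ν₀,
on the time interval [0, T). -/
def IsCoagSolutionMult (ν₀ : Measure ℝ) (T : ℝ) (ν : ℝ → Measure ℝ) : Prop :=
  -- measures concentrated on (0,∞)
  (∀ t : ℝ, t ∈ Set.Ico 0 T → (ν t) (Set.Iic 0) = 0) ∧
  -- (2) measurability of t ↦ ν_t(B) for compact B ⊂ (0,∞)
  (∀ B : Set ℝ, IsCompact B → B ⊆ Set.Ioi 0 →
    Measurable fun t => ((ν t) B).toReal) ∧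
  -- (3) local square-integrability of the second moment m₂(τ)
  (∀ t : ℝ, t ∈ Set.Ioo 0 T →
    IntegrableOn (fun τ => ((secondMoment (ν τ)).toReal) ^ 2) (Set.Ioc 0 t) volume) ∧
  -- (4) weak form of the equation for all test functions f ∈ E₂
  (∀ f : ℝ → ℝ, MemE2 f → ∀ t : ℝ, t ∈ Set.Ico 0 T →
    (∀ τ ∈ Set.Icc (0:ℝ) t,
      IntegrableOn (fun p : ℝ × ℝ => (f (p.1 + p.2) - f p.1 - f p.2) * (p.1 * p.2))
        ((Set.Ioi (0:ℝ)) ×ˢ (Set.Ioi (0:ℝ))) ((ν τ).prod (ν τ))) ∧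
    IntegrableOn f (Set.Ioi 0) (ν t) ∧ IntegrableOn f (Set.Ioi 0) ν₀ ∧
    ∫ x in Set.Ioi (0:ℝ), f x ∂(ν t) =
      (∫ x in Set.Ioi (0:ℝ), f x ∂ν₀) +
        ∫ τ in (0:ℝ)..t, coagPairing (fun x y => x * y) (ν τ) f)

/-- Measures on `(0,∞)` with finite second moment. -/
def GoodM (ν : Measure ℝ) : Prop := ν (Iic 0) = 0 ∧ Integrable (fun x : ℝ => x ^ 2) ν

def LU (ν : Measure ℝ) (s : ℝ) : ℝ := ∫ x, x * (1 - exp (-s * x)) ∂ν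
def LP (ν : Measure ℝ) (s : ℝ) : ℝ := ∫ x, (exp (-s * x) - 1 + s * x) ∂ν
def Lf (ν : Measure ℝ) (s : ℝ) : ℝ := ∫ x, x ^ 2 * exp (-s * x) ∂ν
def M2 (ν : Measure ℝ) : ℝ := ∫ x, x ^ 2 ∂ν

lemma ae_pos_of_null {ν : Measure ℝ} (h : ν (Iic 0) = 0) : ∀ᵐ x ∂ν, 0 < x := by
  rw [ae_iff]
  convert h using 2
  ext x; simp

lemma restrict_of_null {ν : Measure ℝ} (h : ν (Iic 0) = 0) : ν.restrict (Ioi 0) = ν :=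
  Measure.restrict_eq_self_of_ae_mem (ae_pos_of_null h)

lemma sfinite_of_integrable {ν : Measure ℝ} {g : ℝ → ℝ} (h : ν (Iic 0) = 0)
    (hg : Measurable g) (hpos : ∀ x, 0 < x → 0 < g x) (hi : Integrable g ν) : SFinite ν := by
  have h1 : Measurable (fun x => ENNReal.ofReal (g x)) := hg.ennreal_ofReal
  have h2 := withDensity_inv_same (μ := ν) h1
    (by filter_upwards [ae_pos_of_null h] with x hx; simpa using hpos x hx)
    (by filter_upwards with x; exact ENNReal.ofReal_ne_top)
  have : IsFiniteMeasure (ν.withDensity (fun x => ENNReal.ofReal (g x))) :=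
    isFiniteMeasure_withDensity_ofReal hi.2
  rw [← h2]
  infer_instance

lemma exp_sub_abs_le {a b c x : ℝ} (hx : 0 ≤ x) (ha : c ≤ a) (hb : c ≤ b) :
    |exp (-a * x) - exp (-b * x)| ≤ x * exp (-c * x) * |a - b| := by
  wlog hab : a ≤ b generalizing a b
  · rw [abs_sub_comm, abs_sub_comm a b]; exact this hb ha (le_of_not_ge hab)
  have h1 : exp (-b * x) ≤ exp (-a * x) := exp_le_exp.2 (by nlinarith)
  rw [abs_of_nonneg (by linarith), abs_of_nonpos (by linarith)]
  have h2 : exp (-b * x) = exp (-a * x) * exp (-((b - a) * x)) := by rw [← exp_add]; ring_nf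
  have h3 : 1 - (b - a) * x ≤ exp (-((b - a) * x)) := by
    have := add_one_le_exp (-((b - a) * x)); linarith
  have h4 : exp (-a * x) ≤ exp (-c * x) := exp_le_exp.2 (by nlinarith)
  have h5 : 0 ≤ (b - a) * x := mul_nonneg (by linarith) hx
  have := exp_pos (-a * x)
  rw [h2]
  nlinarith

lemma one_sub_exp_le (y : ℝ) : 1 - exp (-y) ≤ y := by
  have := add_one_le_exp (-y); linarith

lemma exp_second_le {y : ℝ} (hy : 0 ≤ y) : exp (-y) - 1 + y ≤ y ^ 2 := by
  have h1 : 1 + y ≤ exp y := by linarith [add_one_le_exp y]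
  have h2 : exp (-y) ≤ (1 + y)⁻¹ := by rw [exp_neg]; exact inv_anti₀ (by linarith) h1
  have h3 : (1 + y)⁻¹ ≤ 1 - y + y ^ 2 := by
    rw [inv_le_iff_one_le_mul₀ (by linarith)]
    nlinarith [pow_nonneg hy 3]
  linarith

lemma x_exp_le {c x : ℝ} (hc : 0 < c) : x * exp (-c * x) ≤ 1 / c := by
  have h1 : c * x ≤ exp (c * x) := by linarith [add_one_le_exp (c * x)]
  rw [neg_mul, exp_neg, ← div_eq_mul_inv, div_le_div_iff₀ (exp_pos _) hc]
  linarith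

namespace GoodM
variable {ν : Measure ℝ}

lemma ae_pos (h : GoodM ν) : ∀ᵐ x ∂ν, 0 < x := ae_pos_of_null h.1

lemma sfinite (h : GoodM ν) : SFinite ν :=
  sfinite_of_integrable h.1 (by fun_prop) (fun x hx => by positivity) h.2

lemma integrable (h : GoodM ν) {g : ℝ → ℝ} (hg : AEStronglyMeasurable g ν) (C : ℝ)
    (hC : ∀ x, 0 < x → |g x| ≤ C * x ^ 2) : Integrable g ν := by
  refine Integrable.mono' (h.2.const_mul C) hg ?_
  filter_upwards [h.ae_pos] with x hx
  simpa using hC x hx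

lemma bU {s x : ℝ} (hs : 0 ≤ s) (hx : 0 < x) : |x * (1 - exp (-s * x))| ≤ s * x ^ 2 := by
  have h1 : exp (-s * x) ≤ 1 := exp_le_one_iff.2 (by nlinarith [mul_nonneg hs hx.le])
  have h2 : 1 - exp (-s * x) ≤ s * x := by
    have := one_sub_exp_le (s * x); rwa [← neg_mul] at this
  rw [abs_of_nonneg (mul_nonneg hx.le (by linarith))]
  nlinarith

lemma intU (h : GoodM ν) {s : ℝ} (hs : 0 ≤ s) :
    Integrable (fun x => x * (1 - exp (-s * x))) ν :=
  h.integrable (by fun_prop) s (fun _ hx => bU hs hx)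

lemma bP {s x : ℝ} (hs : 0 ≤ s) (hx : 0 < x) : |exp (-s * x) - 1 + s * x| ≤ s ^ 2 * x ^ 2 := by
  have := exp_second_le (mul_nonneg hs hx.le)
  have h2 := one_sub_exp_le (s * x)
  rw [← neg_mul] at this h2
  rw [abs_of_nonneg (by linarith)]
  linarith [mul_pow s x 2]

lemma intP (h : GoodM ν) {s : ℝ} (hs : 0 ≤ s) :
    Integrable (fun x => exp (-s * x) - 1 + s * x) ν :=
  h.integrable (by fun_prop) (s ^ 2) (fun _ hx => bP hs hx)

lemma bf {s x : ℝ} (hs : 0 ≤ s) (hx : 0 < x) : |x ^ 2 * exp (-s * x)| ≤ 1 * x ^ 2 := by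
  have h1 : exp (-s * x) ≤ 1 := exp_le_one_iff.2 (by nlinarith [mul_nonneg hs hx.le])
  rw [abs_of_nonneg (by positivity)]
  nlinarith [sq_nonneg x]

lemma intf (h : GoodM ν) {s : ℝ} (hs : 0 ≤ s) :
    Integrable (fun x => x ^ 2 * exp (-s * x)) ν :=
  h.integrable (by fun_prop) 1 (fun _ hx => bf hs hx)

lemma abs_integral_le (h : GoodM ν) {g : ℝ → ℝ} (C : ℝ)
    (hC : ∀ x, 0 < x → |g x| ≤ C * x ^ 2) : |∫ x, g x ∂ν| ≤ C * M2 ν := by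
  rw [M2, ← integral_const_mul, ← Real.norm_eq_abs]
  refine norm_integral_le_of_norm_le (h.2.const_mul C) ?_
  filter_upwards [h.ae_pos] with x hx
  simpa using hC x hx

lemma LU_nonneg (h : GoodM ν) {s : ℝ} (hs : 0 ≤ s) : 0 ≤ LU ν s := by
  refine integral_nonneg_of_ae ?_
  filter_upwards [h.ae_pos] with x hx
  have h1 : exp (-s * x) ≤ 1 := exp_le_one_iff.2 (by nlinarith [mul_nonneg hs hx.le])
  exact mul_nonneg hx.le (by linarith)

lemma LU_le (h : GoodM ν) {s : ℝ} (hs : 0 ≤ s) : LU ν s ≤ s * M2 ν :=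
  (le_abs_self _).trans (h.abs_integral_le s (fun _ hx => bU hs hx))

lemma LP_abs_le (h : GoodM ν) {s : ℝ} (hs : 0 ≤ s) : |LP ν s| ≤ s ^ 2 * M2 ν :=
  (h.abs_integral_le (s ^ 2) (fun _ hx => bP hs hx))

lemma Lf_le (h : GoodM ν) {s : ℝ} (hs : 0 ≤ s) : Lf ν s ≤ M2 ν := by
  rw [← one_mul (M2 ν)]
  exact (le_abs_self _).trans (h.abs_integral_le 1 (fun _ hx => bf hs hx))

lemma Lf_nonneg (s : ℝ) : 0 ≤ Lf ν s := integral_nonneg (fun x => by positivity)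

lemma M2_nonneg : 0 ≤ M2 ν := integral_nonneg (fun x => by positivity)

lemma LU_zero : LU ν 0 = 0 := by simp [LU]
lemma LP_zero : LP ν 0 = 0 := by simp [LP]

lemma LU_lip (h : GoodM ν) {a b : ℝ} (ha : 0 ≤ a) (hb : 0 ≤ b) :
    |LU ν a - LU ν b| ≤ |a - b| * M2 ν := by
  rw [LU, LU, ← integral_sub (h.intU ha) (h.intU hb)]
  refine h.abs_integral_le _ (fun x hx => ?_)
  have := exp_sub_abs_le hx.le hb ha
  have h2 : x * (1 - exp (-a * x)) - x * (1 - exp (-b * x)) = x * (exp (-b * x) - exp (-a * x)) := by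
    ring
  rw [h2, abs_mul, abs_of_pos hx]
  simp only [neg_zero, zero_mul, exp_zero, mul_one] at this
  rw [abs_sub_comm a b]
  nlinarith

lemma LU_mono (h : GoodM ν) {a b : ℝ} (ha : 0 ≤ a) (hab : a ≤ b) : LU ν a ≤ LU ν b := by
  refine integral_mono_ae (h.intU ha) (h.intU (ha.trans hab)) ?_
  filter_upwards [h.ae_pos] with x hx
  have : exp (-b * x) ≤ exp (-a * x) := exp_le_exp.2 (by nlinarith)
  exact mul_le_mul_of_nonneg_left (by linarith) hx.le

lemma LU_pos (h : GoodM ν) (hM : 0 < M2 ν) {s : ℝ} (hs : 0 < s) : 0 < LU ν s := by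
  rcases (h.LU_nonneg hs.le).lt_or_eq with h1 | h1
  · exact h1
  exfalso
  have h2 : 0 ≤ᵐ[ν] (fun x => x * (1 - exp (-s * x))) := by
    filter_upwards [h.ae_pos] with x hx
    have h1 : exp (-s * x) ≤ 1 := exp_le_one_iff.2 (by nlinarith [mul_nonneg hs.le hx.le])
    exact mul_nonneg hx.le (by linarith)
  have h3 := (integral_eq_zero_iff_of_nonneg_ae h2 (h.intU hs.le)).1 h1.symm
  have h4 : ∀ᵐ x ∂ν, False := by
    filter_upwards [h3, h.ae_pos] with x h3 hx
    have h1 : exp (-s * x) < 1 := exp_lt_one_iff.2 (by nlinarith [mul_pos hs hx])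
    have : 0 < x * (1 - exp (-s * x)) := mul_pos hx (by linarith)
    simp only [Pi.zero_apply] at h3
    linarith
  have h5 : ν = 0 := by
    rw [← Measure.measure_univ_eq_zero]; simpa [ae_iff] using h4
  simp [M2, h5] at hM

lemma hasDeriv_LU (h : GoodM ν) {s : ℝ} (hs : 0 < s) : HasDerivAt (LU ν) (Lf ν s) s := by
  have key := hasDerivAt_integral_of_dominated_loc_of_deriv_le (μ := ν) (𝕜 := ℝ)
    (F := fun s x => x * (1 - exp (-s * x))) (F' := fun s x => x ^ 2 * exp (-s * x))
    (x₀ := s) (s := Ioi 0) (bound := fun x => 1 * x ^ 2) (Ioi_mem_nhds hs)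
    (by filter_upwards with s; fun_prop) (h.intU hs.le) (by fun_prop)
    (by filter_upwards [h.ae_pos] with x hx; intro s hs; simpa using bf (le_of_lt hs) hx)
    (h.2.const_mul 1)
    (by
      filter_upwards with x; intro s hs
      have h1 : HasDerivAt (fun s : ℝ => exp (-s * x)) (exp (-s * x) * (-1 * x)) s :=
        ((hasDerivAt_id s).neg.mul_const x).exp
      exact ((h1.const_sub 1).const_mul x).congr_deriv (by ring))
  exact key.2

lemma hasDeriv_LP (h : GoodM ν) {s : ℝ} (hs : 0 < s) : HasDerivAt (LP ν) (LU ν s) s := by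
  have key := hasDerivAt_integral_of_dominated_loc_of_deriv_le (μ := ν) (𝕜 := ℝ)
    (F := fun s x => exp (-s * x) - 1 + s * x) (F' := fun s x => x * (1 - exp (-s * x)))
    (x₀ := s) (s := Ioo 0 (s + 1)) (bound := fun x => (s + 1) * x ^ 2)
    (Ioo_mem_nhds hs (by linarith))
    (by filter_upwards with s; fun_prop) (h.intP hs.le) (by fun_prop)
    (by
      filter_upwards [h.ae_pos] with x hx; intro r hr
      have := bU hr.1.le hx
      rw [Real.norm_eq_abs]
      nlinarith [hr.2, sq_nonneg x])
    (h.2.const_mul _)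
    (by
      filter_upwards with x; intro s hs
      have h1 : HasDerivAt (fun s : ℝ => exp (-s * x)) (exp (-s * x) * (-1 * x)) s :=
        ((hasDerivAt_id s).neg.mul_const x).exp
      exact ((h1.sub_const 1).add ((hasDerivAt_id s).mul_const x)).congr_deriv (by ring))
  exact key.2

lemma Lf_lip (h : GoodM ν) {a b c : ℝ} (hc : 0 < c) (ha : c ≤ a) (hb : c ≤ b) :
    |Lf ν a - Lf ν b| ≤ (1 / c * |a - b|) * M2 ν := by
  rw [Lf, Lf, ← integral_sub (h.intf (hc.le.trans ha)) (h.intf (hc.le.trans hb))]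
  refine h.abs_integral_le _ (fun x hx => ?_)
  have := exp_sub_abs_le hx.le ha hb
  have h3 := x_exp_le (x := x) hc
  rw [← mul_sub, abs_mul, abs_of_nonneg (sq_nonneg x)]
  have h4 : |exp (-a * x) - exp (-b * x)| ≤ 1 / c * |a - b| :=
    this.trans (mul_le_mul_of_nonneg_right h3 (abs_nonneg _))
  nlinarith [sq_nonneg x]

lemma LU_div_tendsto (h : GoodM ν) : Tendsto (fun s => LU ν s / s) atTop (𝓝 0) := by
  have key := tendsto_integral_filter_of_dominated_convergence (μ := ν) (l := atTop)
    (F := fun (s : ℝ) x => x * (1 - exp (-s * x)) / s) (f := fun _ => (0 : ℝ))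
    (fun x => x ^ 2) (by filter_upwards with s; fun_prop)
    (by
      filter_upwards [eventually_gt_atTop 0] with s hs
      filter_upwards [h.ae_pos] with x hx
      have := bU hs.le hx
      rw [Real.norm_eq_abs, abs_div, abs_of_pos hs, div_le_iff₀ hs]
      linarith)
    h.2
    (by
      filter_upwards [h.ae_pos] with x hx
      refine squeeze_zero' (g := fun s => x / s) ?_ ?_ (tendsto_const_nhds.div_atTop tendsto_id)
      · filter_upwards [eventually_gt_atTop 0] with s hs
        have h1 : exp (-s * x) ≤ 1 := exp_le_one_iff.2 (by nlinarith [mul_nonneg hs.le hx.le])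
        exact div_nonneg (mul_nonneg hx.le (by linarith)) hs.le
      · filter_upwards [eventually_gt_atTop 0] with s hs
        have := exp_pos (-s * x)
        exact div_le_div_of_nonneg_right (by nlinarith) hs.le)
  simp only [integral_zero] at key
  refine key.congr (fun s => ?_)
  rw [LU, ← integral_div]

end GoodM

open Classical in
def Sig (ν : Measure ℝ) (t s : ℝ) : ℝ :=
  if h : ∃ σ : ℝ, s ≤ σ ∧ σ - t * LU ν σ = s then h.choose else 0

def Qu (ν : Measure ℝ) (t s : ℝ) : ℝ := LU ν (Sig ν t s)
def PP (ν : Measure ℝ) (t s : ℝ) : ℝ := LP ν (Sig ν t s) - t * (LU ν (Sig ν t s)) ^ 2 / 2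

namespace GoodM
variable {ν : Measure ℝ}

lemma contOn_LU (h : GoodM ν) : ContinuousOn (LU ν) (Ici 0) := by
  have : LipschitzOnWith (M2 ν).toNNReal (LU ν) (Ici 0) := by
    refine LipschitzOnWith.of_dist_le_mul (fun a ha b hb => ?_)
    rw [Real.dist_eq, Real.dist_eq, Real.coe_toNNReal _ M2_nonneg, mul_comm]
    exact h.LU_lip ha hb
  exact this.continuousOn

lemma sig_exists (h : GoodM ν) {t s : ℝ} (ht : 0 ≤ t) (htm : t * M2 ν < 1) (hs : 0 ≤ s) :
    ∃ σ : ℝ, s ≤ σ ∧ σ - t * LU ν σ = s := by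
  have h1 : 0 < 1 - t * M2 ν := by linarith
  have hle : s ≤ s / (1 - t * M2 ν) := by
    rw [le_div_iff₀ h1]
    nlinarith [mul_nonneg hs (mul_nonneg ht (M2_nonneg (ν := ν)))]
  have hc : ContinuousOn (fun σ => σ - t * LU ν σ) (Icc s (s / (1 - t * M2 ν))) :=
    continuousOn_id.sub (continuousOn_const.mul
      (h.contOn_LU.mono (fun x hx => hs.trans hx.1)))
  have := intermediate_value_Icc hle hc
  have hmem : s ∈ Icc (s - t * LU ν s) (s / (1 - t * M2 ν) - t * LU ν (s / (1 - t * M2 ν))) := by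
    constructor
    · nlinarith [mul_nonneg ht (h.LU_nonneg hs)]
    · have h2 := h.LU_le (hs.trans hle)
      have h3 : s / (1 - t * M2 ν) * (1 - t * M2 ν) = s := by field_simp
      nlinarith
  obtain ⟨σ, hσ, hσ2⟩ := this hmem
  exact ⟨σ, hσ.1, hσ2⟩

lemma sig_spec (h : GoodM ν) {t s : ℝ} (ht : 0 ≤ t) (htm : t * M2 ν < 1) (hs : 0 ≤ s) :
    s ≤ Sig ν t s ∧ Sig ν t s - t * LU ν (Sig ν t s) = s := by
  have := h.sig_exists ht htm hs
  rw [Sig, dif_pos this]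
  exact this.choose_spec

lemma psi_lip (h : GoodM ν) {t a b : ℝ} (ht : 0 ≤ t) (ha : 0 ≤ a) (hb : 0 ≤ b) :
    (1 - t * M2 ν) * |a - b| ≤ |(a - t * LU ν a) - (b - t * LU ν b)| := by
  have h1 := h.LU_lip ha hb
  have h2 : (a - t * LU ν a) - (b - t * LU ν b) = (a - b) - t * (LU ν a - LU ν b) := by ring
  have h3 := abs_sub_abs_le_abs_sub (a - b) (t * (LU ν a - LU ν b))
  rw [abs_mul, abs_of_nonneg ht] at h3
  rw [h2]
  nlinarith

lemma sig_unique (h : GoodM ν) {t s a : ℝ} (ht : 0 ≤ t) (htm : t * M2 ν < 1) (hs : 0 ≤ s)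
    (ha : 0 ≤ a) (hae : a - t * LU ν a = s) : Sig ν t s = a := by
  obtain ⟨h1, h2⟩ := h.sig_spec ht htm hs
  have := h.psi_lip ht (hs.trans h1) ha
  rw [h2, hae, sub_self, abs_zero] at this
  have h3 : |Sig ν t s - a| ≤ 0 := by
    by_contra hcon
    push Not at hcon
    nlinarith
  have := abs_nonpos_iff.1 h3
  linarith

lemma sig_zero_t (h : GoodM ν) {s : ℝ} (hs : 0 ≤ s) : Sig ν 0 s = s :=
  h.sig_unique le_rfl (by simp) hs hs (by simp)

lemma sig_le (h : GoodM ν) {t s : ℝ} (ht : 0 ≤ t) (htm : t * M2 ν < 1) (hs : 0 ≤ s) :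
    Sig ν t s ≤ s / (1 - t * M2 ν) := by
  obtain ⟨h1, h2⟩ := h.sig_spec ht htm hs
  rw [le_div_iff₀ (by linarith)]
  have := h.LU_le (hs.trans h1)
  nlinarith

lemma sig_lip_s (h : GoodM ν) {t a b : ℝ} (ht : 0 ≤ t) (htm : t * M2 ν < 1) (ha : 0 ≤ a)
    (hb : 0 ≤ b) : |Sig ν t a - Sig ν t b| ≤ (1 - t * M2 ν)⁻¹ * |a - b| := by
  obtain ⟨h1, h2⟩ := h.sig_spec ht htm ha
  obtain ⟨h3, h4⟩ := h.sig_spec ht htm hb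
  have := h.psi_lip ht (ha.trans h1) (hb.trans h3)
  rw [h2, h4] at this
  rw [inv_mul_eq_div, le_div_iff₀ (by linarith)]
  linarith

lemma sig_lip_t (h : GoodM ν) {t t' s : ℝ} (ht : 0 ≤ t) (htm : t * M2 ν < 1)
    (ht' : 0 ≤ t') (htm' : t' * M2 ν < 1) (hs : 0 ≤ s) :
    |Sig ν t' s - Sig ν t s| ≤ |t' - t| * LU ν (Sig ν t s) * (1 - t' * M2 ν)⁻¹ := by
  obtain ⟨h1, h2⟩ := h.sig_spec ht htm hs
  obtain ⟨h3, h4⟩ := h.sig_spec ht' htm' hs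
  have := h.psi_lip ht' (hs.trans h3) (hs.trans h1)
  rw [h4] at this
  have h5 : s - (Sig ν t s - t' * LU ν (Sig ν t s)) = (t' - t) * LU ν (Sig ν t s) := by
    linarith
  rw [h5, abs_mul, abs_of_nonneg (h.LU_nonneg (hs.trans h1))] at this
  rw [← div_eq_mul_inv, le_div_iff₀ (by linarith)]
  linarith

lemma contOn_sig_t (h : GoodM ν) {s : ℝ} (hs : 0 ≤ s) :
    ContinuousOn (fun t => Sig ν t s) {t | 0 ≤ t ∧ t * M2 ν < 1} := by
  intro t ht
  rw [ContinuousWithinAt, tendsto_iff_dist_tendsto_zero]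
  have hlim : Tendsto (fun t' => |t' - t| * LU ν (Sig ν t s) * (1 - t' * M2 ν)⁻¹)
      (𝓝[{t | 0 ≤ t ∧ t * M2 ν < 1}] t) (𝓝 0) := by
    have : ContinuousAt (fun t' => |t' - t| * LU ν (Sig ν t s) * (1 - t' * M2 ν)⁻¹) t := by
      refine ContinuousAt.mul (by fun_prop) (ContinuousAt.inv₀ (by fun_prop) ?_)
      have := ht.2; linarith
    have h2 := this.tendsto
    simp only [sub_self, abs_zero, zero_mul] at h2
    exact h2.mono_left nhdsWithin_le_nhds
  refine squeeze_zero' (Eventually.of_forall fun _ => dist_nonneg) ?_ hlim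
  filter_upwards [self_mem_nhdsWithin] with t' ht'
  rw [Real.dist_eq]
  exact h.sig_lip_t ht.1 ht.2 ht'.1 ht'.2 hs

lemma contOn_Qu_t (h : GoodM ν) {s : ℝ} (hs : 0 ≤ s) :
    ContinuousOn (fun t => Qu ν t s) {t | 0 ≤ t ∧ t * M2 ν < 1} :=
  h.contOn_LU.comp (h.contOn_sig_t hs)
    (fun t ht => hs.trans (h.sig_spec ht.1 ht.2 hs).1)

lemma contOn_LP (h : GoodM ν) : ContinuousOn (LP ν) (Ici 0) := by
  intro x hx
  rcases (show (0:ℝ) ≤ x from hx).lt_or_eq with h1 | h1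
  · exact (h.hasDeriv_LP h1).continuousAt.continuousWithinAt
  · subst h1
    rw [ContinuousWithinAt, LP_zero]
    refine squeeze_zero_norm' (a := fun s => s ^ 2 * M2 ν) ?_ ?_
    · filter_upwards [self_mem_nhdsWithin] with s hs
      exact h.LP_abs_le hs
    · have : ContinuousAt (fun s : ℝ => s ^ 2 * M2 ν) 0 := by fun_prop
      have h2 := this.tendsto
      simp only [ne_eq, OfNat.ofNat_ne_zero, not_false_eq_true, zero_pow, zero_mul] at h2
      exact h2.mono_left nhdsWithin_le_nhds

lemma contOn_PP_t (h : GoodM ν) {s : ℝ} (hs : 0 ≤ s) :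
    ContinuousOn (fun t => PP ν t s) {t | 0 ≤ t ∧ t * M2 ν < 1} := by
  unfold PP
  refine (h.contOn_LP.comp (h.contOn_sig_t hs)
    (fun t ht => hs.trans (h.sig_spec ht.1 ht.2 hs).1)).sub ?_
  have := h.contOn_Qu_t hs
  unfold Qu at this
  exact (continuousOn_id.mul (this.pow 2)).div_const 2

/-- the auxiliary function `σ ↦ LP σ - t (LU σ)^2/2`. -/
lemma hasDeriv_Sig_s (h : GoodM ν) {t s : ℝ} (ht : 0 ≤ t) (htm : t * M2 ν < 1) (hs : 0 < s) :
    HasDerivAt (Sig ν t) (1 - t * Lf ν (Sig ν t s))⁻¹ s := by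
  obtain ⟨h1, h2⟩ := h.sig_spec ht htm hs.le
  have hσ : 0 < Sig ν t s := hs.trans_le h1
  have hf : HasDerivAt (fun σ => σ - t * LU ν σ) (1 - t * Lf ν (Sig ν t s)) (Sig ν t s) :=
    (hasDerivAt_id _).sub ((h.hasDeriv_LU hσ).const_mul t)
  refine HasDerivAt.of_local_left_inverse ?_ hf ?_ ?_
  · have : ContinuousOn (Sig ν t) (Ici 0) := by
      have : LipschitzOnWith ((1 - t * M2 ν)⁻¹).toNNReal (Sig ν t) (Ici 0) := by
        refine LipschitzOnWith.of_dist_le_mul (fun a ha b hb => ?_)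
        rw [Real.dist_eq, Real.dist_eq, Real.coe_toNNReal _ (inv_nonneg.2 (by linarith))]
        exact h.sig_lip_s ht htm ha hb
      exact this.continuousOn
    exact this.continuousAt (Ici_mem_nhds hs)
  · have := h.Lf_le hσ.le
    nlinarith
  · filter_upwards [Ioi_mem_nhds hs] with r hr
    exact (h.sig_spec ht htm (le_of_lt hr)).2

lemma hasDeriv_PP_s (h : GoodM ν) {t s : ℝ} (ht : 0 ≤ t) (htm : t * M2 ν < 1) (hs : 0 < s) :
    HasDerivAt (PP ν t) (Qu ν t s) s := by
  obtain ⟨h1, h2⟩ := h.sig_spec ht htm hs.le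
  have hσ : 0 < Sig ν t s := hs.trans_le h1
  have hd := h.hasDeriv_Sig_s ht htm hs
  have hU := (h.hasDeriv_LU hσ).comp s hd
  have hP := (h.hasDeriv_LP hσ).comp s hd
  have hne : 1 - t * Lf ν (Sig ν t s) ≠ 0 := by
    have := h.Lf_le hσ.le
    nlinarith
  refine (hP.sub (((hU.pow 2).const_mul t).div_const 2)).congr_deriv ?_
  simp only [Function.comp, Qu]
  field_simp
  push_cast
  ring

lemma hasDeriv_Sig_t (h : GoodM ν) (hM : 0 < M2 ν) {t s : ℝ} (ht : 0 < t) (htm : t * M2 ν < 1)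
    (hs : 0 < s) : HasDerivAt (fun t => Sig ν t s)
      ((1 - t * Lf ν (Sig ν t s)) / LU ν (Sig ν t s))⁻¹ t := by
  obtain ⟨h1, h2⟩ := h.sig_spec ht.le htm hs.le
  have hσ : 0 < Sig ν t s := hs.trans_le h1
  have hU : 0 < LU ν (Sig ν t s) := h.LU_pos hM hσ
  have hf : HasDerivAt (fun σ => (σ - s) / LU ν σ)
      ((1 - t * Lf ν (Sig ν t s)) / LU ν (Sig ν t s)) (Sig ν t s) := by
    refine (((hasDerivAt_id _).sub_const s).div (h.hasDeriv_LU hσ) hU.ne').congr_deriv ?_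
    have : Sig ν t s - s = t * LU ν (Sig ν t s) := by linarith
    simp only [id, this]
    field_simp
  have hmem : {t | 0 ≤ t ∧ t * M2 ν < 1} ∈ 𝓝 t := by
    have : IsOpen {t : ℝ | 0 < t ∧ t * M2 ν < 1} :=
      (isOpen_lt continuous_const continuous_id).inter
        (isOpen_lt (continuous_id.mul continuous_const) continuous_const)
    filter_upwards [this.mem_nhds ⟨ht, htm⟩] with r hr
    exact ⟨hr.1.le, hr.2⟩
  refine HasDerivAt.of_local_left_inverse ?_ hf ?_ ?_
  · exact (h.contOn_sig_t hs.le).continuousAt hmem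
  · have := h.Lf_le hσ.le
    exact (div_pos (by nlinarith) hU).ne'
  · filter_upwards [hmem] with r hr
    obtain ⟨h3, h4⟩ := h.sig_spec hr.1 hr.2 hs.le
    have h5 : 0 < LU ν (Sig ν r s) := h.LU_pos hM (hs.trans_le h3)
    rw [div_eq_iff h5.ne']
    linarith

lemma hasDeriv_PP_t (h : GoodM ν) (hM : 0 < M2 ν) {t s : ℝ} (ht : 0 < t) (htm : t * M2 ν < 1)
    (hs : 0 < s) : HasDerivAt (fun t => PP ν t s) ((Qu ν t s) ^ 2 / 2) t := by
  obtain ⟨h1, h2⟩ := h.sig_spec ht.le htm hs.le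
  have hσ : 0 < Sig ν t s := hs.trans_le h1
  have hd := h.hasDeriv_Sig_t hM ht htm hs
  have hUp : 0 < LU ν (Sig ν t s) := h.LU_pos hM hσ
  have hU := (h.hasDeriv_LU hσ).comp t hd
  have hP := (h.hasDeriv_LP hσ).comp t hd
  have hne : 1 - t * Lf ν (Sig ν t s) ≠ 0 := by
    have := h.Lf_le hσ.le
    nlinarith
  refine (hP.sub (((hasDerivAt_id t).mul (hU.pow 2)).div_const 2)).congr_deriv ?_
  simp only [Function.comp, Qu, id, Pi.pow_apply]
  field_simp
  push_cast
  ring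

lemma PP_eq_integral (h : GoodM ν) (hM : 0 < M2 ν) {t s : ℝ} (ht : 0 ≤ t) (htm : t * M2 ν < 1)
    (hs : 0 < s) : PP ν t s = LP ν s + ∫ τ in (0:ℝ)..t, (Qu ν τ s) ^ 2 / 2 := by
  have hsub : Icc 0 t ⊆ {t | 0 ≤ t ∧ t * M2 ν < 1} := fun r hr =>
    ⟨hr.1, lt_of_le_of_lt (mul_le_mul_of_nonneg_right hr.2 hM.le) htm⟩
  have key := intervalIntegral.integral_eq_sub_of_hasDerivAt_of_le ht
    ((h.contOn_PP_t hs.le).mono hsub)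
    (fun r hr => h.hasDeriv_PP_t hM hr.1 (hsub ⟨hr.1.le, hr.2.le⟩).2 hs)
    (ContinuousOn.intervalIntegrable (by
      rw [uIcc_of_le ht]
      exact (((h.contOn_Qu_t hs.le).mono hsub).pow 2).div_const 2))
  rw [key]
  have : PP ν 0 s = LP ν s := by simp [PP, h.sig_zero_t hs.le]
  rw [this]; ring

lemma PP_abs_le (h : GoodM ν) {t s : ℝ} (ht : 0 ≤ t) (htm : t * M2 ν < 1) (hs : 0 ≤ s) :
    |PP ν t s| ≤ ((s / (1 - t * M2 ν)) ^ 2 * M2 ν + t * (s / (1 - t * M2 ν) * M2 ν) ^ 2) := by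
  obtain ⟨h1, h2⟩ := h.sig_spec ht htm hs
  have h3 := h.sig_le ht htm hs
  have h4 := h.LP_abs_le (hs.trans h1)
  have h5 := h.LU_le (hs.trans h1)
  have h6 := h.LU_nonneg (hs.trans h1)
  have hM := M2_nonneg (ν := ν)
  have h7 : (Sig ν t s) ^ 2 ≤ (s / (1 - t * M2 ν)) ^ 2 :=
    pow_le_pow_left₀ (hs.trans h1) h3 2
  have h8 : (LU ν (Sig ν t s)) ^ 2 ≤ (s / (1 - t * M2 ν) * M2 ν) ^ 2 :=
    pow_le_pow_left₀ h6 (h5.trans (mul_le_mul_of_nonneg_right h3 hM)) 2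
  unfold PP
  refine (abs_sub _ _).trans (add_le_add ?_ ?_)
  · exact h4.trans (mul_le_mul_of_nonneg_right h7 hM)
  · rw [abs_of_nonneg (by positivity)]
    have := mul_le_mul_of_nonneg_left h8 ht
    nlinarith [mul_nonneg ht (sq_nonneg (LU ν (Sig ν t s)))]

lemma LP_eq_PP (h : GoodM ν) {ρ : Measure ℝ} (hρ : GoodM ρ) {t : ℝ} (ht : 0 ≤ t)
    (htm : t * M2 ν < 1) (hU : ∀ s, 0 < s → LU ρ s = Qu ν t s) {s : ℝ} (hs : 0 < s) :
    LP ρ s = PP ν t s := by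
  set D := fun s => LP ρ s - PP ν t s with hD
  have hder : ∀ r ∈ Ioi (0:ℝ), HasDerivAt D 0 r := fun r hr =>
    ((hρ.hasDeriv_LP hr).sub (h.hasDeriv_PP_s ht htm hr)).congr_deriv (by rw [hU r hr]; ring)
  have hconst : ∀ r, 0 < r → D r = D s := fun r hr => by
    have := Convex.norm_image_sub_le_of_norm_hasDerivWithin_le (f := D) (f' := fun _ => 0) (C := 0)
      (s := Ioi 0) (x := s) (y := r) (fun x hx => (hder x hx).hasDerivWithinAt) (by simp)
      (convex_Ioi 0) hs hr
    simp only [zero_mul] at this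
    have := norm_le_zero_iff.1 this
    linarith
  have hlim : Tendsto D (𝓝[>] 0) (𝓝 0) := by
    refine squeeze_zero_norm' (a := fun s => s ^ 2 * M2 ρ + ((s / (1 - t * M2 ν)) ^ 2 * M2 ν +
      t * (s / (1 - t * M2 ν) * M2 ν) ^ 2)) ?_ ?_
    · filter_upwards [self_mem_nhdsWithin] with r hr
      rw [hD, Real.norm_eq_abs]
      exact (abs_sub _ _).trans (add_le_add (hρ.LP_abs_le (le_of_lt hr))
        (h.PP_abs_le ht htm (le_of_lt hr)))
    · have : Continuous (fun s : ℝ => s ^ 2 * M2 ρ + ((s / (1 - t * M2 ν)) ^ 2 * M2 ν +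
        t * (s / (1 - t * M2 ν) * M2 ν) ^ 2)) := by fun_prop
      have h2 := this.tendsto 0
      simp only [ne_eq, OfNat.ofNat_ne_zero, not_false_eq_true, zero_pow, zero_mul, zero_div,
        mul_zero, add_zero] at h2
      exact h2.mono_left nhdsWithin_le_nhds
  have hlim2 : Tendsto D (𝓝[>] 0) (𝓝 (D s)) := by
    refine tendsto_const_nhds.congr' ?_
    filter_upwards [self_mem_nhdsWithin] with r hr
    exact (hconst r hr).symm
  have := tendsto_nhds_unique hlim2 hlim
  simp only [hD] at this
  linarith

lemma Qu_nonneg (h : GoodM ν) {t s : ℝ} (ht : 0 ≤ t) (htm : t * M2 ν < 1) (hs : 0 ≤ s) :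
    0 ≤ Qu ν t s := h.LU_nonneg (hs.trans (h.sig_spec ht htm hs).1)

lemma Qu_le (h : GoodM ν) {t s : ℝ} (ht : 0 ≤ t) (htm : t * M2 ν < 1) (hs : 0 ≤ s) :
    Qu ν t s ≤ s * (M2 ν / (1 - t * M2 ν)) := by
  have h1 := h.LU_le (hs.trans (h.sig_spec ht htm hs).1)
  have h2 := mul_le_mul_of_nonneg_right (h.sig_le ht htm hs) (M2_nonneg (ν := ν))
  unfold Qu
  calc _ ≤ _ := h1
    _ ≤ _ := h2
    _ = _ := by ring

lemma Qu_fix (h : GoodM ν) {t s : ℝ} (ht : 0 ≤ t) (htm : t * M2 ν < 1) (hs : 0 ≤ s) :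
    Qu ν t s = LU ν (s + t * Qu ν t s) := by
  have := (h.sig_spec ht htm hs).2
  have h2 : s + t * Qu ν t s = Sig ν t s := by rw [Qu]; linarith
  rw [h2, Qu]

lemma Qu_div_tendsto (h : GoodM ν) {t : ℝ} (ht : 0 ≤ t) (htm : t * M2 ν < 1) :
    Tendsto (fun s => Qu ν t s / s) atTop (𝓝 0) := by
  have h1 : 0 < 1 - t * M2 ν := by linarith
  have hS : Tendsto (Sig ν t) atTop atTop := by
    refine tendsto_atTop_mono' atTop ?_ tendsto_id
    filter_upwards [eventually_ge_atTop 0] with s hs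
    exact (h.sig_spec ht htm hs).1
  have h2 := (h.LU_div_tendsto.comp hS).const_mul (1 - t * M2 ν)⁻¹
  rw [mul_zero] at h2
  refine squeeze_zero' ?_ ?_ h2
  · filter_upwards [eventually_ge_atTop 0] with s hs
    exact div_nonneg (h.Qu_nonneg ht htm hs) hs
  · filter_upwards [eventually_gt_atTop 0] with s hs
    have h3 := h.sig_le ht htm hs.le
    have h4 := h.Qu_nonneg ht htm hs.le
    have h5 : 0 < Sig ν t s := hs.trans_le (h.sig_spec ht htm hs.le).1
    simp only [Function.comp]
    change Qu ν t s / s ≤ (1 - t * M2 ν)⁻¹ * (Qu ν t s / Sig ν t s)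
    rw [le_div_iff₀ h1] at h3
    rw [inv_mul_eq_div, div_div, div_le_div_iff₀ hs (by positivity)]
    exact mul_le_mul_of_nonneg_left h3 h4

end GoodM

/-- convolution powers -/
def cpow (l : Measure ℝ) : ℕ → Measure ℝ
  | 0 => Measure.dirac 0
  | k + 1 => Measure.conv l (cpow l k)

def LL (l : Measure ℝ) (s : ℝ) : ENNReal := ∫⁻ x, ENNReal.ofReal (exp (-s * x)) ∂l

instance cpow_finite (l : Measure ℝ) [IsFiniteMeasure l] (k : ℕ) : IsFiniteMeasure (cpow l k) := by
  induction k with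
  | zero => unfold cpow; infer_instance
  | succ k ih => unfold cpow; infer_instance

lemma LL_conv (a b : Measure ℝ) [SFinite b] (s : ℝ) :
    LL (Measure.conv a b) s = LL a s * LL b s := by
  unfold LL
  rw [Measure.lintegral_conv (by fun_prop)]
  have : ∀ x y : ℝ, ENNReal.ofReal (exp (-s * (x + y))) =
      ENNReal.ofReal (exp (-s * x)) * ENNReal.ofReal (exp (-s * y)) := fun x y => by
    rw [← ENNReal.ofReal_mul (exp_pos _).le, ← exp_add, mul_add]
  simp_rw [this]
  simp_rw [lintegral_const_mul _ (show Measurable fun y : ℝ => ENNReal.ofReal (exp (-s * y)) by fun_prop)]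
  rw [lintegral_mul_const _ (by fun_prop)]

lemma LL_cpow (l : Measure ℝ) [IsFiniteMeasure l] (s : ℝ) (k : ℕ) :
    LL (cpow l k) s = LL l s ^ k := by
  induction k with
  | zero => simp [cpow, LL]
  | succ k ih => rw [cpow, LL_conv, ih, pow_succ, mul_comm]

lemma conv_pos (a b : Measure ℝ) [SFinite a] [SFinite b] (ha : ∀ᵐ x ∂a, 0 < x) (hb : ∀ᵐ x ∂b, 0 ≤ x) :
    ∀ᵐ x ∂(Measure.conv a b), 0 < x := by
  unfold Measure.conv
  rw [ae_map_iff (by fun_prop) measurableSet_Ioi]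
  filter_upwards [Measure.quasiMeasurePreserving_fst.ae ha, Measure.quasiMeasurePreserving_snd.ae hb]
    with z h1 h2
  exact add_pos_of_pos_of_nonneg h1 h2

lemma cpow_nonneg (l : Measure ℝ) [IsFiniteMeasure l] (hl : ∀ᵐ x ∂l, 0 < x) (k : ℕ) :
    ∀ᵐ x ∂(cpow l k), 0 ≤ x := by
  cases k with
  | zero => simp [cpow, ae_dirac_iff measurableSet_Ici]
  | succ k =>
    have ih := cpow_nonneg l hl k
    filter_upwards [conv_pos l (cpow l k) hl ih] with x hx using hx.le

lemma LL_eq (l : Measure ℝ) [IsFiniteMeasure l] (hl : ∀ᵐ x ∂l, 0 < x) {s : ℝ} (hs : 0 ≤ s) :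
    Integrable (fun x => exp (-s * x)) l ∧
    LL l s = ENNReal.ofReal (∫ x, exp (-s * x) ∂l) := by
  have hi : Integrable (fun x => exp (-s * x)) l := by
    refine Integrable.mono' (integrable_const (1:ℝ)) (by fun_prop) ?_
    filter_upwards [hl] with x hx
    rw [Real.norm_eq_abs, abs_of_pos (exp_pos _)]
    exact exp_le_one_iff.2 (by nlinarith [mul_nonneg hs hx.le])
  exact ⟨hi, (ofReal_integral_eq_lintegral_ofReal hi (Eventually.of_forall fun x => (exp_pos _).le)).symm⟩

lemma cp_exists (l μ : Measure ℝ) [IsFiniteMeasure l] [IsFiniteMeasure μ]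
    (hl : ∀ᵐ x ∂l, 0 < x) (hμ : ∀ᵐ x ∂μ, 0 < x) {t : ℝ} (ht : 0 ≤ t) :
    ∃ l' : Measure ℝ, IsFiniteMeasure l' ∧ (∀ᵐ x ∂l', 0 < x) ∧
      ∀ s, 0 ≤ s → ∫ x, (1 - exp (-s * x)) ∂l' =
        ∫ x, (1 - exp (-(s + t * ∫ y, (1 - exp (-s * y)) ∂l) * x)) ∂μ := by
  set m := l.real univ with hm
  let w : ℕ → ℝ → ENNReal := fun k x =>
    ENNReal.ofReal (exp (-(t * x * m)) * ((t * x) ^ k / (k.factorial : ℝ)))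
  have hw : ∀ k, Measurable (w k) := fun k => by fun_prop
  have hwf : ∀ k, ∀ x, w k x < ⊤ := fun k x => ENNReal.ofReal_lt_top
  let l' : Measure ℝ := Measure.sum (fun k => Measure.conv (μ.withDensity (w k)) (cpow l k))
  have key : ∀ s, 0 ≤ s → LL l' s =
      ∫⁻ x, ENNReal.ofReal (exp (-(s + t * (m - ∫ y, exp (-s * y) ∂l)) * x)) ∂μ := by
    intro s hs
    obtain ⟨hi, hL⟩ := LL_eq l hl hs
    set r := ∫ y, exp (-s * y) ∂l with hr
    have hr0 : 0 ≤ r := integral_nonneg (fun x => (exp_pos _).le)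
    have h1 : LL l' s = ∑' k, ∫⁻ x, w k x * ENNReal.ofReal (exp (-s * x)) * ENNReal.ofReal (r ^ k) ∂μ := by
      simp only [LL, l']
      rw [lintegral_sum_measure]
      congr 1
      ext k
      have := LL_conv (μ.withDensity (w k)) (cpow l k) s
      rw [LL_cpow, hL, LL, LL] at this
      rw [this, lintegral_withDensity_eq_lintegral_mul _ (hw k) (by fun_prop),
        lintegral_mul_const _ (by fun_prop), ENNReal.ofReal_pow hr0]
      rfl
    rw [h1, ← lintegral_tsum (fun k => by fun_prop)]
    refine lintegral_congr_ae ?_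
    filter_upwards [hμ] with x hx
    have htx : 0 ≤ t * x := mul_nonneg ht hx.le
    have h2 : ∀ k : ℕ, w k x * ENNReal.ofReal (exp (-s * x)) * ENNReal.ofReal (r ^ k) =
        ENNReal.ofReal (exp (-(t * x * m)) * exp (-s * x) * ((t * x * r) ^ k / (k.factorial : ℝ))) := by
      intro k
      simp only [w]
      rw [← ENNReal.ofReal_mul (by positivity), ← ENNReal.ofReal_mul (by positivity)]
      congr 1
      rw [mul_pow (t * x)]
      ring
    have h3 : HasSum (fun k : ℕ => (t * x * r) ^ k / (k.factorial : ℝ)) (exp (t * x * r)) := by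
      have := NormedSpace.expSeries_div_hasSum_exp (𝔸 := ℝ) (t * x * r)
      rwa [← Real.exp_eq_exp_ℝ] at this
    have h4 := h3.mul_left (exp (-(t * x * m)) * exp (-s * x))
    simp_rw [h2]
    rw [← ENNReal.ofReal_tsum_of_nonneg (fun k => by positivity) h4.summable, h4.tsum_eq,
      ← exp_add, ← exp_add]
    congr 2
    ring
  have hm0 : m = ∫ y, exp (-0 * y) ∂l := by simp [hm]
  have hfin : IsFiniteMeasure l' := by
    have := key 0 le_rfl
    rw [← hm0, LL] at this
    simp only [neg_zero, zero_mul, exp_zero, ENNReal.ofReal_one, lintegral_const, one_mul, sub_self,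
      mul_zero, add_zero] at this
    exact ⟨by rw [this]; exact measure_lt_top μ _⟩
  have hpos : ∀ᵐ x ∂l', 0 < x := by
    simp only [l']
    rw [Measure.ae_sum_iff]
    intro k
    refine conv_pos _ _ ?_ (cpow_nonneg l hl k)
    exact (withDensity_absolutelyContinuous μ (w k)).ae_le hμ
  refine ⟨l', hfin, hpos, fun s hs => ?_⟩
  have hv : ∫ y, (1 - exp (-s * y)) ∂l = m - ∫ y, exp (-s * y) ∂l := by
    rw [integral_sub (integrable_const _) (LL_eq l hl hs).1]; simp [hm]
  have hle : ∫ y, exp (-s * y) ∂l ≤ m := by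
    have : 0 ≤ ∫ y, (1 - exp (-s * y)) ∂l := by
      refine integral_nonneg_of_ae ?_
      filter_upwards [hl] with x hx
      have := exp_le_one_iff.2 (show -s * x ≤ 0 by nlinarith [mul_nonneg hs hx.le])
      simp only [Pi.zero_apply]; linarith
    linarith
  rw [hv]
  set c := s + t * (m - ∫ y, exp (-s * y) ∂l) with hc
  have hc0 : 0 ≤ c := add_nonneg hs (mul_nonneg ht (by linarith))
  obtain ⟨hi1, hL1⟩ := LL_eq l' hpos hs
  obtain ⟨hi2, hL2⟩ := LL_eq μ hμ hc0
  obtain ⟨hi3, hL3⟩ := LL_eq l' hpos le_rfl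
  obtain ⟨hi4, hL4⟩ := LL_eq μ hμ le_rfl
  have e1 : ∫ x, exp (-s * x) ∂l' = ∫ x, exp (-c * x) ∂μ := by
    have := key s hs
    rw [hL1] at this
    change _ = LL μ c at this
    rw [hL2] at this
    exact (ENNReal.ofReal_eq_ofReal_iff (integral_nonneg (fun x => (exp_pos _).le))
      (integral_nonneg (fun x => (exp_pos _).le))).1 this
  have e2 : l'.real univ = μ.real univ := by
    have := key 0 le_rfl
    rw [← hm0, sub_self, mul_zero, add_zero] at this
    change _ = LL μ 0 at this
    rw [hL3, hL4] at this
    have := (ENNReal.ofReal_eq_ofReal_iff (integral_nonneg (fun x => (exp_pos _).le))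
      (integral_nonneg (fun x => (exp_pos _).le))).1 this
    simpa using this
  rw [integral_sub (integrable_const _) hi1, integral_sub (integrable_const _) hi2, e1]
  simp [e2]

lemma rec_tendsto {e δ : ℕ → ℝ} {κ : ℝ} (he : ∀ n, 0 ≤ e n) (hκ0 : 0 ≤ κ) (hκ : κ < 1)
    (hδ : Tendsto δ atTop (𝓝 0)) (hrec : ∀ n, e (n + 1) ≤ κ * e n + δ n) :
    Tendsto e atTop (𝓝 0) := by
  rw [Metric.tendsto_atTop]
  intro ε hε
  have h1 : ∀ᶠ n in atTop, δ n < ε / 2 * (1 - κ) :=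
    hδ.eventually_lt_const (mul_pos (by linarith) (by linarith))
  obtain ⟨N, hN⟩ := eventually_atTop.1 h1
  have h2 : ∀ k, e (N + k) ≤ ε / 2 + κ ^ k * e N := by
    intro k
    induction k with
    | zero => simp; linarith
    | succ k ih =>
      have h3 := hrec (N + k)
      have h4 := hN (N + k) (by lia)
      have h5 := mul_le_mul_of_nonneg_left ih hκ0
      rw [← add_assoc, pow_succ]
      nlinarith
  have h3 : Tendsto (fun k => κ ^ k * e N) atTop (𝓝 0) := by
    simpa using (tendsto_pow_atTop_nhds_zero_of_lt_one hκ0 hκ).mul_const (e N)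
  obtain ⟨K, hK⟩ := eventually_atTop.1 (h3.eventually_lt_const (half_pos hε))
  refine ⟨N + K, fun n hn => ?_⟩
  obtain ⟨k, rfl⟩ := Nat.exists_eq_add_of_le (show N ≤ n by lia)
  rw [Real.dist_eq, sub_zero, abs_of_nonneg (he _)]
  linarith [h2 k, hK k (by lia)]

/-- the quotient `(1-z^s)/(1-z)` -/
def Gs (s : ℝ) : ℝ → ℝ := dslope (fun z : ℝ => z ^ s) 1

lemma Gs_cont {s : ℝ} (hs : 0 < s) : Continuous (Gs s) := by
  rw [← continuousOn_univ]
  refine (continuousOn_dslope univ_mem).2 ⟨(Real.continuous_rpow_const hs.le).continuousOn, ?_⟩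
  exact (Real.hasDerivAt_rpow_const (Or.inl one_ne_zero)).differentiableAt

lemma Gs_one (s : ℝ) : Gs s 1 = s := by
  rw [Gs, dslope_same, (Real.hasDerivAt_rpow_const (Or.inl one_ne_zero)).deriv]; simp

lemma Gs_ne (s : ℝ) {z : ℝ} (hz : z ≠ 1) : Gs s z = (1 - z ^ s) / (1 - z) := by
  rw [Gs, dslope_of_ne _ hz, slope_def_field, Real.one_rpow, ← neg_div_neg_eq]; simp

lemma Gs_zero {s : ℝ} (hs : 0 < s) : Gs s 0 = 1 := by
  rw [Gs_ne s (by norm_num), Real.zero_rpow hs.ne']; norm_num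

lemma Gs_exp (s : ℝ) {x : ℝ} (hx : 0 < x) :
    Gs s (exp (-x)) = (1 - exp (-s * x)) / (1 - exp (-x)) := by
  rw [Gs_ne s (by simp [hx.ne']), ← Real.exp_mul]
  congr 3; ring

lemma Gs_nonneg {s z : ℝ} (hs : 0 < s) (hz : 0 ≤ z) (hz1 : z ≤ 1) : 0 ≤ Gs s z := by
  rcases hz1.eq_or_lt with rfl | h
  · rw [Gs_one]; exact hs.le
  · rw [Gs_ne s h.ne]
    exact div_nonneg (by linarith [Real.rpow_le_one hz hz1 hs.le]) (by linarith)

def clamp (z : ℝ) : ℝ := max 0 (min z 1)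

lemma clamp_cont : Continuous clamp := by unfold clamp; fun_prop
lemma clamp_mem (z : ℝ) : clamp z ∈ Icc (0 : ℝ) 1 := by
  unfold clamp; constructor <;> simp
lemma clamp_of_mem {z : ℝ} (h : z ∈ Icc (0 : ℝ) 1) : clamp z = z := by
  unfold clamp; rw [min_eq_left h.2, max_eq_right h.1]

/-- bounded continuous function from a continuous one on `[0,1]` -/
def clampB (g : ℝ → ℝ) (hg : Continuous g) : BoundedContinuousFunction ℝ ℝ :=
  BoundedContinuousFunction.ofNormedAddCommGroup (fun z => g (clamp z)) (hg.comp clamp_cont)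
    ((isCompact_Icc (a := (0:ℝ)) (b := 1)).exists_bound_of_continuousOn hg.continuousOn).choose
    (fun z => ((isCompact_Icc (a := (0:ℝ)) (b := 1)).exists_bound_of_continuousOn
      hg.continuousOn).choose_spec _ (clamp_mem z))

lemma compact_limit (l : ℕ → Measure ℝ) (hfin : ∀ n, IsFiniteMeasure (l n))
    (hpos : ∀ n, ∀ᵐ x ∂(l n), 0 < x) (q : ℝ → ℝ)
    (hq : ∀ s, 0 < s → Tendsto (fun n => ∫ x, (1 - exp (-s * x)) ∂(l n)) atTop (𝓝 (q s))) :
    ∃ r : Measure ℝ, IsFiniteMeasure r ∧ r (Icc 0 1)ᶜ = 0 ∧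
      ∀ s, 0 < s → ∫ z, Gs s z ∂r = q s := by
  let d : ℝ → ENNReal := fun x => ENNReal.ofReal (1 - exp (-x))
  have hd : Measurable d := by fun_prop
  let k : ℕ → Measure ℝ := fun n => ((l n).withDensity d).map (fun x => exp (-x))
  have hIntg : ∀ n (g : ℝ → ℝ), Continuous g →
      ∫ z, g z ∂(k n) = ∫ x, (1 - exp (-x)) * g (exp (-x)) ∂(l n) := by
    intro n g hg
    have : ∫ z, g z ∂(k n) = ∫ x, g (exp (-x)) ∂((l n).withDensity d) :=
      integral_map (by fun_prop) hg.aestronglyMeasurable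
    rw [this, integral_withDensity_eq_integral_toReal_smul hd (by filter_upwards with x; simp [d])]
    refine integral_congr_ae ?_
    filter_upwards [hpos n] with x hx
    have : exp (-x) ≤ 1 := exp_le_one_iff.2 (by linarith)
    simp only [d, smul_eq_mul]
    rw [ENNReal.toReal_ofReal (by linarith)]
  have hkfin : ∀ n, IsFiniteMeasure (k n) := by
    intro n
    have : IsFiniteMeasure ((l n).withDensity d) := by
      refine isFiniteMeasure_withDensity (ne_of_lt ?_)
      calc ∫⁻ x, d x ∂(l n) ≤ ∫⁻ x, 1 ∂(l n) := by
            refine lintegral_mono fun x => ?_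
            simp only [d]
            rw [← ENNReal.ofReal_one]
            exact ENNReal.ofReal_le_ofReal (by linarith [exp_pos (-x)])
        _ < ⊤ := by simp
    show IsFiniteMeasure (Measure.map _ _)
    infer_instance
  have hksupp : ∀ n, (k n) (Icc 0 1)ᶜ = 0 := by
    intro n
    rw [Measure.map_apply (by fun_prop) measurableSet_Icc.compl]
    refine withDensity_absolutelyContinuous _ _ ?_
    refine measure_mono_null ?_ (ae_iff.1 (hpos n))
    intro x hx hx0
    exact hx ⟨(exp_pos _).le, exp_le_one_iff.2 (by linarith)⟩
  have hkclamp : ∀ (r : Measure ℝ), r (Icc 0 1)ᶜ = 0 → ∀ g : ℝ → ℝ,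
      ∫ z, g (clamp z) ∂r = ∫ z, g z ∂r := by
    intro r hr g
    refine integral_congr_ae ?_
    have : ∀ᵐ z ∂r, z ∈ Icc (0:ℝ) 1 := by rw [ae_iff]; exact hr
    filter_upwards [this] with z hz
    rw [clamp_of_mem hz]
  have hmass : ∃ C : NNReal, ∀ n, (k n) univ ≤ C := by
    obtain ⟨C, hC⟩ := (hq 1 one_pos).bddAbove_range
    refine ⟨C.toNNReal, fun n => ?_⟩
    have h1 := hIntg n (fun _ => 1) continuous_const
    have h2 : ∫ x, (1 - exp (-1 * x)) ∂(l n) ≤ C := hC ⟨n, rfl⟩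
    simp only [integral_const, mul_one, smul_eq_mul] at h1
    simp only [neg_mul, one_mul] at h2
    rw [← h1, measureReal_def] at h2
    rw [← ENNReal.ofReal_toReal (measure_ne_top (k n) univ)]
    exact ENNReal.ofReal_le_ofReal h2
  obtain ⟨C, hC⟩ := hmass
  let K : ℕ → FiniteMeasure ℝ := fun n => ⟨k n, hkfin n⟩
  have hmem : ∀ n, K n ∈ {μ : FiniteMeasure ℝ | μ.mass ≤ C ∧ μ (Icc 0 1)ᶜ = 0} := by
    intro n
    refine ⟨?_, ?_⟩
    · rw [← ENNReal.coe_le_coe, FiniteMeasure.ennreal_mass]; exact hC n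
    · rw [← ENNReal.coe_inj, FiniteMeasure.ennreal_coeFn_eq_coeFn_toMeasure]; exact hksupp n
  obtain ⟨r, hr, hlim⟩ := (isCompact_setOfPred_finiteMeasure_le_of_isCompact C
    (isCompact_Icc (a := (0:ℝ)) (b := 1))).ultrafilter_le_nhds' ((hyperfilter ℕ).map K)
      (by
        rw [Ultrafilter.mem_map]
        exact univ_mem' hmem)
  have hr0 : (r : Measure ℝ) (Icc 0 1)ᶜ = 0 := by
    have := hr.2
    rw [← ENNReal.coe_inj, FiniteMeasure.ennreal_coeFn_eq_coeFn_toMeasure] at this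
    simpa using this
  refine ⟨r, inferInstance, hr0, fun s hs => ?_⟩
  have ht : Tendsto K (hyperfilter ℕ : Filter ℕ) (𝓝 r) := hlim
  rw [FiniteMeasure.tendsto_iff_forall_integral_tendsto] at ht
  have h1 := ht (clampB (Gs s) (Gs_cont hs))
  have h2 : ∀ n, ∫ z, clampB (Gs s) (Gs_cont hs) z ∂(K n : Measure ℝ)
      = ∫ x, (1 - exp (-s * x)) ∂(l n) := by
    intro n
    refine (hkclamp (k n) (hksupp n) (Gs s)).trans ?_
    rw [hIntg n _ (Gs_cont hs)]
    refine integral_congr_ae ?_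
    filter_upwards [hpos n] with x hx
    have : exp (-x) < 1 := exp_lt_one_iff.2 (by linarith)
    rw [Gs_exp s hx, mul_div_cancel₀ _ (by linarith)]
  simp only [h2] at h1
  have h3 := tendsto_nhds_unique h1 ((hq s hs).mono_left Nat.hyperfilter_le_atTop)
  rw [← h3]
  exact (hkclamp r hr0 (Gs s)).symm

lemma atoms_zero {r : Measure ℝ} [IsFiniteMeasure r] {q : ℝ → ℝ} {C : ℝ}
    (hr : r (Icc 0 1)ᶜ = 0) (hG : ∀ s, 0 < s → ∫ z, Gs s z ∂r = q s)
    (hq : ∀ s, 0 < s → q s ≤ s * C) (hq2 : Tendsto (fun s => q s / s) atTop (𝓝 0)) :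
    (∀ᵐ z ∂r, z ∈ Ioo (0:ℝ) 1) ∧ ∀ s, 0 < s → Integrable (Gs s) r := by
  have hae : ∀ᵐ z ∂r, z ∈ Icc (0:ℝ) 1 := by rw [ae_iff]; exact hr
  have hIntg : ∀ s, 0 < s → Integrable (Gs s) r := by
    intro s hs
    obtain ⟨B, hB⟩ := (isCompact_Icc (a := (0:ℝ)) (b := 1)).exists_bound_of_continuousOn
      (Gs_cont hs).continuousOn
    refine Integrable.of_bound (Gs_cont hs).aestronglyMeasurable B ?_
    filter_upwards [hae] with z hz using hB z hz
  have hnn : ∀ s, 0 < s → 0 ≤ᵐ[r] Gs s := by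
    intro s hs
    filter_upwards [hae] with z hz using Gs_nonneg hs hz.1 hz.2
  have h0 : r.real {0} = 0 := by
    have h1 : ∀ s, 0 < s → r.real {0} ≤ s * C := by
      intro s hs
      have h2 := mul_meas_ge_le_integral_of_nonneg (hnn s hs) (hIntg s hs) 1
      rw [hG s hs, one_mul] at h2
      refine le_trans (measureReal_mono ?_) (h2.trans (hq s hs))
      intro z hz
      rw [mem_singleton_iff.1 hz]; exact (Gs_zero hs).ge
    have h3 : Tendsto (fun s : ℝ => s * C) (𝓝[>] 0) (𝓝 0) := by
      have : Tendsto (fun s : ℝ => s * C) (𝓝 0) (𝓝 (0 * C)) := by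
        exact (continuous_id.mul continuous_const).tendsto 0
      rw [zero_mul] at this
      exact this.mono_left nhdsWithin_le_nhds
    exact le_antisymm (ge_of_tendsto h3 (by filter_upwards [self_mem_nhdsWithin] with s hs using h1 s hs))
      measureReal_nonneg
  have h1 : r.real {1} = 0 := by
    have h1 : ∀ s, 0 < s → r.real {1} ≤ q s / s := by
      intro s hs
      have h2 := mul_meas_ge_le_integral_of_nonneg (hnn s hs) (hIntg s hs) s
      rw [hG s hs] at h2
      rw [le_div_iff₀ hs, mul_comm]
      refine le_trans (mul_le_mul_of_nonneg_left (measureReal_mono ?_) hs.le) h2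
      intro z hz
      rw [mem_singleton_iff.1 hz]; exact (Gs_one s).ge
    exact le_antisymm (ge_of_tendsto hq2 (by filter_upwards [eventually_gt_atTop 0] with s hs using h1 s hs))
      measureReal_nonneg
  refine ⟨?_, hIntg⟩
  have h0' : ∀ᵐ z ∂r, z ≠ 0 := by
    rw [ae_iff]; simpa using (measureReal_eq_zero_iff).1 h0
  have h1' : ∀ᵐ z ∂r, z ≠ 1 := by
    rw [ae_iff]; simpa using (measureReal_eq_zero_iff).1 h1
  filter_upwards [hae, h0', h1'] with z hz hz0 hz1
  exact ⟨lt_of_le_of_ne hz.1 (Ne.symm hz0), lt_of_le_of_ne hz.2 hz1⟩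

lemma fatou_second {r : Measure ℝ} {C : ℝ} (hC : 0 ≤ C) (hpos : ∀ᵐ x ∂r, 0 < x)
    (h : ∀ s, 0 < s → ∫⁻ x, ENNReal.ofReal (x * (1 - exp (-s * x))) ∂r ≤ ENNReal.ofReal (s * C)) :
    ∫⁻ x, ENNReal.ofReal (x ^ 2) ∂r ≤ ENNReal.ofReal C := by
  let f : ℕ → ℝ → ENNReal := fun n x =>
    ENNReal.ofReal ((n + 1) * (x * (1 - exp (-(1 / ((n:ℝ) + 1)) * x))))
  have hf : ∀ n, Measurable (f n) := fun n => by fun_prop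
  have hlim : ∀ x : ℝ, Tendsto (fun n => f n x) atTop (𝓝 (ENNReal.ofReal (x ^ 2))) := by
    intro x
    refine (ENNReal.continuous_ofReal.tendsto _).comp ?_
    have hd : HasDerivAt (fun s : ℝ => x * (1 - exp (-s * x))) (x ^ 2) 0 := by
      have h1 : HasDerivAt (fun s : ℝ => -s * x) (-1 * x) 0 := ((hasDerivAt_id 0).neg).mul_const x
      have h2 := ((h1.exp).const_sub 1).const_mul x
      have e : x ^ 2 = x * -(exp (-0 * x) * (-1 * x)) := by simp; ring
      rw [e]; exact h2
    have h3 := hd.tendsto_slope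
    have h4 : Tendsto (fun n : ℕ => 1 / ((n:ℝ) + 1)) atTop (𝓝[≠] 0) := by
      rw [tendsto_nhdsWithin_iff]
      refine ⟨tendsto_one_div_add_atTop_nhds_zero_nat, ?_⟩
      filter_upwards with n
      have : (0:ℝ) < 1 / ((n:ℝ) + 1) := by positivity
      exact this.ne'
    refine (h3.comp h4).congr fun n => ?_
    have : ((n:ℝ) + 1) ≠ 0 := by positivity
    simp [slope_def_field]
    field_simp
  calc ∫⁻ x, ENNReal.ofReal (x ^ 2) ∂r = ∫⁻ x, liminf (fun n => f n x) atTop ∂r := by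
        refine lintegral_congr fun x => ?_
        rw [(hlim x).liminf_eq]
    _ ≤ liminf (fun n => ∫⁻ x, f n x ∂r) atTop := lintegral_liminf_le hf
    _ ≤ liminf (fun _ : ℕ => ENNReal.ofReal C) atTop := by
        refine liminf_le_liminf (Eventually.of_forall fun n => ?_)
        have h1 := h (1 / ((n:ℝ) + 1)) (by positivity)
        have h2 : ∀ x, f n x = ENNReal.ofReal ((n:ℝ) + 1) *
            ENNReal.ofReal (x * (1 - exp (-(1 / ((n:ℝ) + 1)) * x))) := fun x => by
          simp only [f]; rw [ENNReal.ofReal_mul (by positivity)]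
        simp only [h2]
        rw [lintegral_const_mul _ (by fun_prop)]
        refine (mul_le_mul_right h1 _).trans ?_
        rw [← ENNReal.ofReal_mul (by positivity)]
        refine ENNReal.ofReal_le_ofReal (le_of_eq ?_)
        field_simp
    _ = ENNReal.ofReal C := by simp

lemma measure_of_limit {r : Measure ℝ} [IsFiniteMeasure r] {q : ℝ → ℝ} {C : ℝ} (hC : 0 ≤ C)
    (hr : r (Icc 0 1)ᶜ = 0) (hG : ∀ s, 0 < s → ∫ z, Gs s z ∂r = q s)
    (hq : ∀ s, 0 < s → q s ≤ s * C) (hq2 : Tendsto (fun s => q s / s) atTop (𝓝 0)) :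
    ∃ ρ : Measure ℝ, GoodM ρ ∧ (∀ s, 0 < s → LU ρ s = q s) ∧ M2 ρ ≤ C := by
  obtain ⟨hae, hIntg⟩ := atoms_zero hr hG hq hq2
  let w : ℝ → ENNReal := fun x => ENNReal.ofReal (1 / (x * (1 - exp (-x))))
  have hw : Measurable w := by
    simp only [w]
    exact (measurable_const.div (by fun_prop)).ennreal_ofReal
  have hmlog : Measurable (fun z : ℝ => -Real.log z) := Real.measurable_log.neg
  let ρ := (r.map (fun z => -Real.log z)).withDensity w
  have hposm : ∀ᵐ x ∂(r.map (fun z => -Real.log z)), 0 < x := by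
    rw [ae_map_iff hmlog.aemeasurable measurableSet_Ioi]
    filter_upwards [hae] with z hz
    have := Real.log_neg hz.1 hz.2
    linarith
  have hpos : ∀ᵐ x ∂ρ, 0 < x := (withDensity_absolutelyContinuous _ _).ae_le hposm
  have hnull : ρ (Iic 0) = 0 := by
    have := ae_iff.1 hpos
    convert this using 2
    ext x; simp
  have hl : ∀ s, 0 < s → ∫⁻ x, ENNReal.ofReal (x * (1 - exp (-s * x))) ∂ρ = ENNReal.ofReal (q s) := by
    intro s hs
    rw [lintegral_withDensity_eq_lintegral_mul _ hw (by fun_prop), lintegral_map (hw.mul (by fun_prop)) hmlog,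
      ← hG s hs, ofReal_integral_eq_lintegral_ofReal (hIntg s hs)]
    · refine lintegral_congr_ae ?_
      filter_upwards [hae] with z hz
      have hlog := Real.log_neg hz.1 hz.2
      have h1 : z = exp (-(-Real.log z)) := by rw [neg_neg, exp_log hz.1]
      have hx : 0 < -Real.log z := by linarith
      conv_rhs => rw [h1]
      rw [Gs_exp s hx]
      generalize -Real.log z = x at hx
      have h2 : 0 < 1 - exp (-x) := by
        have : exp (-x) < 1 := exp_lt_one_iff.2 (by linarith)
        linarith
      simp only [w, Pi.mul_apply]
      rw [← ENNReal.ofReal_mul (by positivity)]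
      congr 1
      field_simp
    · filter_upwards [hae] with z hz using Gs_nonneg hs hz.1.le hz.2.le
  have h2 := fatou_second hC hpos (fun s hs => by
    rw [hl s hs]; exact ENNReal.ofReal_le_ofReal (hq s hs))
  have hgood : GoodM ρ := by
    refine ⟨hnull, by fun_prop, ?_⟩
    rw [hasFiniteIntegral_iff_ofReal (by filter_upwards with x; positivity)]
    exact h2.trans_lt ENNReal.ofReal_lt_top
  refine ⟨ρ, hgood, fun s hs => ?_, ?_⟩
  · have hqn : 0 ≤ q s := by
      rw [← hG s hs]
      refine integral_nonneg_of_ae ?_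
      filter_upwards [hae] with z hz using Gs_nonneg hs hz.1.le hz.2.le
    rw [LU, integral_eq_lintegral_of_nonneg_ae, hl s hs, ENNReal.toReal_ofReal hqn]
    · filter_upwards [hpos] with x hx
      have h1 : exp (-s * x) ≤ 1 := exp_le_one_iff.2 (by nlinarith [mul_nonneg hs.le hx.le])
      exact mul_nonneg hx.le (by linarith)
    · fun_prop
  · rw [M2, integral_eq_lintegral_of_nonneg_ae (by filter_upwards with x; positivity) (by fun_prop)]
    exact ENNReal.toReal_le_of_le_ofReal hC h2

/-- truncated finite measures -/
lemma trunc_exists {ν : Measure ℝ} (h : GoodM ν) (n : ℕ) :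
    ∃ μ : Measure ℝ, IsFiniteMeasure μ ∧ (∀ᵐ x ∂μ, 0 < x) ∧
      ∀ s, 0 ≤ s → ∫ x, (1 - exp (-s * x)) ∂μ = LU (ν.restrict (Ioi (1 / ((n:ℝ) + 1)))) s := by
  let c : ℝ := 1 / ((n:ℝ) + 1)
  have hc : 0 < c := by positivity
  let μ := (ν.restrict (Ioi c)).withDensity (fun x => ENNReal.ofReal x)
  have hae : ∀ᵐ x ∂(ν.restrict (Ioi c)), c < x := ae_restrict_mem measurableSet_Ioi
  have hi : Integrable (fun x : ℝ => x) (ν.restrict (Ioi c)) := by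
    refine Integrable.mono' ((h.2.restrict (s := Ioi c)).const_mul (1 / c)) (by fun_prop) ?_
    filter_upwards [hae] with x hx
    rw [Real.norm_eq_abs, abs_of_pos (hc.trans hx)]
    rw [div_mul_eq_mul_div, le_div_iff₀ hc]
    nlinarith
  refine ⟨μ, ?_, ?_, ?_⟩
  · refine isFiniteMeasure_withDensity (ne_of_lt ?_)
    have := hi.2
    rwa [hasFiniteIntegral_iff_ofReal] at this
    filter_upwards [hae] with x hx using (hc.trans hx).le
  · refine (withDensity_absolutelyContinuous _ _).ae_le ?_
    filter_upwards [hae] with x hx using hc.trans hx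
  · intro s hs
    rw [integral_withDensity_eq_integral_toReal_smul (by fun_prop) (by filter_upwards with x; simp), LU]
    refine integral_congr_ae ?_
    filter_upwards [hae] with x hx
    rw [ENNReal.toReal_ofReal (hc.trans hx).le, smul_eq_mul]

lemma trunc_good {ν : Measure ℝ} (h : GoodM ν) (A : Set ℝ) :
    GoodM (ν.restrict A) ∧ M2 (ν.restrict A) ≤ M2 ν := by
  refine ⟨⟨le_antisymm ((Measure.restrict_apply_le A _).trans h.1.le) (by simp), h.2.restrict⟩, ?_⟩
  exact setIntegral_le_integral h.2 (by filter_upwards with x; positivity)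

lemma trunc_tendsto {ν : Measure ℝ} (h : GoodM ν) {s : ℝ} (hs : 0 ≤ s) :
    Tendsto (fun n : ℕ => LU (ν.restrict (Ioi (1 / ((n:ℝ) + 1)))) s) atTop (𝓝 (LU ν s)) := by
  have h1 : ∀ n : ℕ, LU (ν.restrict (Ioi (1 / ((n:ℝ) + 1)))) s =
      ∫ x, (Ioi (1 / ((n:ℝ) + 1))).indicator (fun x => x * (1 - exp (-s * x))) x ∂ν := by
    intro n
    rw [integral_indicator measurableSet_Ioi]; rfl
  simp only [h1]
  refine tendsto_integral_of_dominated_convergence (fun x => |x * (1 - exp (-s * x))|)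
    (fun n => (Measurable.indicator (by fun_prop) measurableSet_Ioi).aestronglyMeasurable)
    (h.intU hs).abs (fun n => ?_) ?_
  · filter_upwards with x
    rw [← Real.norm_eq_abs]
    exact norm_indicator_le_norm_self _ _
  · filter_upwards [h.ae_pos] with x hx
    refine tendsto_const_nhds.congr' ?_
    filter_upwards [(tendsto_one_div_add_atTop_nhds_zero_nat (𝕜 := ℝ)).eventually_lt_const hx] with n hn
    rw [indicator_of_mem (by exact hn)]

theorem exists_flow {ν : Measure ℝ} (h : GoodM ν) {t : ℝ} (ht : 0 ≤ t) (htm : t * M2 ν < 1) :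
    ∃ ρ : Measure ℝ, GoodM ρ ∧ (∀ s, 0 < s → LU ρ s = Qu ν t s) ∧
      M2 ρ ≤ M2 ν / (1 - t * M2 ν) := by
  choose μ hμf hμp hμ using trunc_exists h
  let FM := {l : Measure ℝ // IsFiniteMeasure l ∧ ∀ᵐ x ∂l, 0 < x}
  have step : ∀ (n : ℕ) (l : FM), ∃ l' : FM, ∀ s, 0 ≤ s → ∫ x, (1 - exp (-s * x)) ∂l'.1 =
      LU (ν.restrict (Ioi (1 / ((n:ℝ) + 1)))) (s + t * ∫ y, (1 - exp (-s * y)) ∂l.1) := by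
    rintro n ⟨l, hl1, hl2⟩
    have := hμf n
    obtain ⟨l', a, b, c⟩ := cp_exists l (μ n) hl2 (hμp n) ht
    refine ⟨⟨l', a, b⟩, fun s hs => ?_⟩
    have hu : 0 ≤ ∫ y, (1 - exp (-s * y)) ∂l := by
      refine integral_nonneg_of_ae ?_
      filter_upwards [hl2] with x hx
      have h1 : exp (-s * x) ≤ 1 := exp_le_one_iff.2 (by nlinarith [mul_nonneg hs hx.le])
      simpa using h1
    rw [← hμ n _ (add_nonneg hs (mul_nonneg ht hu))]
    exact c s hs
  choose S hS using step
  let L : ℕ → FM := fun n => Nat.rec ⟨0, inferInstance, by simp⟩ (fun n l => S n l) n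
  have hL : ∀ n, L (n + 1) = S n (L n) := fun n => rfl
  let u : ℕ → ℝ → ℝ := fun n s => ∫ x, (1 - exp (-s * x)) ∂(L n).1
  have hu0 : ∀ n s, 0 ≤ s → 0 ≤ u n s := by
    intro n s hs
    refine integral_nonneg_of_ae ?_
    filter_upwards [(L n).2.2] with x hx
    have h1 : exp (-s * x) ≤ 1 := exp_le_one_iff.2 (by nlinarith [mul_nonneg hs hx.le])
    simpa using h1
  have hrec : ∀ n s, 0 ≤ s → u (n + 1) s = LU (ν.restrict (Ioi (1 / ((n:ℝ) + 1)))) (s + t * u n s) :=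
    fun n s hs => hS n (L n) s hs
  have hconv : ∀ s, 0 < s → Tendsto (fun n => u n s) atTop (𝓝 (Qu ν t s)) := by
    intro s hs
    rw [tendsto_iff_dist_tendsto_zero]
    have hQ0 := h.Qu_nonneg ht htm hs.le
    have hσ : 0 ≤ s + t * Qu ν t s := add_nonneg hs.le (mul_nonneg ht hQ0)
    refine rec_tendsto (κ := t * M2 ν) (fun n => dist_nonneg) (mul_nonneg ht GoodM.M2_nonneg) htm
      (δ := fun n => dist (LU (ν.restrict (Ioi (1 / ((n:ℝ) + 1)))) (s + t * Qu ν t s))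
        (LU ν (s + t * Qu ν t s))) (tendsto_iff_dist_tendsto_zero.1 (trunc_tendsto h hσ)) ?_
    intro n
    rw [hrec n s hs.le]
    have e : dist (LU (ν.restrict (Ioi (1 / ((n:ℝ) + 1)))) (s + t * u n s)) (Qu ν t s) =
      dist (LU (ν.restrict (Ioi (1 / ((n:ℝ) + 1)))) (s + t * u n s)) (LU ν (s + t * Qu ν t s)) := by
      rw [← h.Qu_fix ht htm hs.le]
    rw [e]
    refine (dist_triangle _ (LU (ν.restrict (Ioi (1 / ((n:ℝ) + 1)))) (s + t * Qu ν t s)) _).trans ?_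
    refine add_le_add ?_ le_rfl
    obtain ⟨hg, hM⟩ := trunc_good h (Ioi (1 / ((n:ℝ) + 1)))
    rw [Real.dist_eq, Real.dist_eq]
    refine (hg.LU_lip (add_nonneg hs.le (mul_nonneg ht (hu0 n s hs.le))) hσ).trans ?_
    have e2 : s + t * u n s - (s + t * Qu ν t s) = t * (u n s - Qu ν t s) := by ring
    rw [e2, abs_mul, abs_of_nonneg ht]
    calc t * |u n s - Qu ν t s| * M2 (ν.restrict (Ioi (1 / ((n:ℝ) + 1))))
        ≤ t * |u n s - Qu ν t s| * M2 ν := mul_le_mul_of_nonneg_left hM (by positivity)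
      _ = _ := by ring
  obtain ⟨r, hrf, hr0, hrG⟩ := compact_limit (fun n => (L n).1) (fun n => (L n).2.1)
    (fun n => (L n).2.2) (Qu ν t) hconv
  exact measure_of_limit (div_nonneg GoodM.M2_nonneg (by linarith)) hr0 hrG
    (fun s hs => h.Qu_le ht htm hs.le) (h.Qu_div_tendsto ht htm)

lemma exp_poly_approx {g : ℝ → ℝ} (hg : ContinuousOn g (Ioi 0)) {a b : ℝ}
    (ha : Tendsto g (𝓝[>] 0) (𝓝 a)) (hb : Tendsto g atTop (𝓝 b)) {ε : ℝ} (hε : 0 < ε) :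
    ∃ P : Polynomial ℝ, |P.eval 0 - b| < ε ∧ ∀ x, 0 < x → |P.eval (exp (-x)) - g x| < ε := by
  let h : ℝ → ℝ := fun z => if z ≤ 0 then b else if 1 ≤ z then a else g (-Real.log z)
  have hcont : ContinuousOn h (Icc 0 1) := by
    intro z hz
    rcases hz.1.eq_or_lt with rfl | hz0
    · have h1 : Tendsto (fun z => g (-Real.log z)) (𝓝[>] 0) (𝓝 b) :=
        hb.comp (tendsto_neg_atBot_atTop.comp Real.tendsto_log_nhdsGT_zero)
      have h0 : h 0 = b := by simp [h]
      rw [ContinuousWithinAt, h0]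
      have h2 : Tendsto h (𝓝[>] 0) (𝓝 b) := by
        refine h1.congr' ?_
        filter_upwards [self_mem_nhdsWithin,
          mem_nhdsWithin_of_mem_nhds (Iio_mem_nhds (zero_lt_one (α := ℝ)))] with z hz hz1
        have hz' : (0:ℝ) < z := hz
        have hz1' : z < 1 := hz1
        simp [h, not_le.2 hz', not_le.2 hz1']
      have h3 : Tendsto h (𝓝[≥] 0) (𝓝 b) := by
        rw [← Ioi_union_left (a := (0:ℝ)), nhdsWithin_union, nhdsWithin_singleton]
        exact h2.sup (by rw [← h0]; exact tendsto_pure_nhds _ _)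
      exact h3.mono_left (nhdsWithin_mono _ Icc_subset_Ici_self)
    rcases hz.2.eq_or_lt with rfl | hz1
    · have h0 : h 1 = a := by simp [h, not_le.2 (zero_lt_one (α := ℝ))]
      have h1 : Tendsto (fun z => g (-Real.log z)) (𝓝[<] 1) (𝓝 a) := by
        refine ha.comp ?_
        rw [tendsto_nhdsWithin_iff]
        constructor
        · have : Tendsto (fun z : ℝ => -Real.log z) (𝓝 1) (𝓝 (-Real.log 1)) :=
            ((Real.continuousAt_log one_ne_zero).neg).tendsto
          simp only [Real.log_one, neg_zero] at this
          exact this.mono_left nhdsWithin_le_nhds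
        · filter_upwards [self_mem_nhdsWithin,
            mem_nhdsWithin_of_mem_nhds (Ioi_mem_nhds (zero_lt_one (α := ℝ)))] with z hz hz1
          have := Real.log_neg hz1 hz
          simp only [mem_Ioi]; linarith
      rw [ContinuousWithinAt, h0]
      have h2 : Tendsto h (𝓝[<] 1) (𝓝 a) := by
        refine h1.congr' ?_
        filter_upwards [self_mem_nhdsWithin,
          mem_nhdsWithin_of_mem_nhds (Ioi_mem_nhds (zero_lt_one (α := ℝ)))] with z hz hz1
        have hz' : (0:ℝ) < z := hz1
        have hz1' : z < 1 := hz
        simp [h, not_le.2 hz', not_le.2 hz1']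
      have h3 : Tendsto h (𝓝[≤] 1) (𝓝 a) := by
        rw [← Iio_union_right (a := (1:ℝ)), nhdsWithin_union, nhdsWithin_singleton]
        exact h2.sup (by rw [← h0]; exact tendsto_pure_nhds _ _)
      exact h3.mono_left (nhdsWithin_mono _ Icc_subset_Iic_self)
    · refine ContinuousAt.continuousWithinAt ?_
      have h1 : ContinuousAt (fun z => g (-Real.log z)) z := by
        refine ContinuousAt.comp (f := fun z : ℝ => -Real.log z) (g := g) ?_ (Real.continuousAt_log hz0.ne').neg
        refine hg.continuousAt (Ioi_mem_nhds ?_)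
        have := Real.log_neg hz0 hz1
        linarith
      refine h1.congr ?_
      filter_upwards [Ioo_mem_nhds hz0 hz1] with w hw
      simp [h, not_le.2 hw.1, not_le.2 hw.2]
  obtain ⟨P, hP⟩ := exists_polynomial_near_of_continuousOn 0 1 h hcont ε hε
  refine ⟨P, ?_, fun x hx => ?_⟩
  · have := hP 0 (by simp)
    simpa [h] using this
  · have h1 : exp (-x) < 1 := exp_lt_one_iff.2 (by linarith)
    have := hP (exp (-x)) ⟨(exp_pos _).le, h1.le⟩
    simpa [h, not_le.2 (exp_pos (-x)), not_le.2 h1] using this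

lemma poly_lim {f : ℝ → ℝ} (hf : Continuous f) : ∃ P : ℕ → Polynomial ℝ, ∀ r : Measure ℝ,
    IsFiniteMeasure r → r (Icc 0 1)ᶜ = 0 →
    Tendsto (fun n => ∫ z, (P n).eval z ∂r) atTop (𝓝 (∫ z, f z ∂r)) := by
  choose P hP using fun n : ℕ => exists_polynomial_near_of_continuousOn 0 1 f hf.continuousOn
    (1 / ((n:ℝ) + 1)) (by positivity)
  refine ⟨P, fun r _ hr => ?_⟩
  have hae : ∀ᵐ z ∂r, z ∈ Icc (0:ℝ) 1 := by rw [ae_iff]; exact hr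
  obtain ⟨B, hB⟩ := (isCompact_Icc (a := (0:ℝ)) (b := 1)).exists_bound_of_continuousOn
      hf.continuousOn
  refine tendsto_integral_of_dominated_convergence (fun _ => B + 1)
    (fun n => (P n).continuous.aestronglyMeasurable) (integrable_const _) (fun n => ?_) ?_
  · filter_upwards [hae] with z hz
    have h1 := hP n z hz
    have h2 := hB z hz
    have h3 : 1 / ((n:ℝ) + 1) ≤ 1 := by
      rw [div_le_one (by positivity)]; linarith [n.cast_nonneg (α := ℝ)]
    rw [Real.norm_eq_abs] at *
    have := abs_sub_abs_le_abs_sub ((P n).eval z) (f z)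
    linarith
  · filter_upwards [hae] with z hz
    rw [tendsto_iff_dist_tendsto_zero]
    refine squeeze_zero (fun _ => dist_nonneg) (fun n => ?_) (tendsto_one_div_add_atTop_nhds_zero_nat (𝕜 := ℝ))
    rw [Real.dist_eq]
    exact (hP n z hz).le

lemma poly_integral (P : Polynomial ℝ) (r : Measure ℝ) [IsFiniteMeasure r] (hr : r (Icc 0 1)ᶜ = 0) :
    ∫ z, P.eval z ∂r = ∑ k ∈ Finset.range (P.natDegree + 1), P.coeff k * ∫ z, z ^ k ∂r := by
  have hae : ∀ᵐ z ∂r, z ∈ Icc (0:ℝ) 1 := by rw [ae_iff]; exact hr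
  simp only [Polynomial.eval_eq_sum_range]
  rw [integral_finsetSum]
  · simp only [integral_const_mul]
  · intro k _
    refine Integrable.const_mul ?_ _
    refine Integrable.of_bound (by fun_prop) 1 ?_
    filter_upwards [hae] with z hz
    rw [Real.norm_eq_abs, abs_of_nonneg (pow_nonneg hz.1 _)]
    exact pow_le_one₀ hz.1 hz.2

lemma ext_of_moments {r r' : Measure ℝ} [IsFiniteMeasure r] [IsFiniteMeasure r']
    (hr : r (Icc 0 1)ᶜ = 0) (hr' : r' (Icc 0 1)ᶜ = 0)
    (h : ∀ k : ℕ, ∫ z, z ^ k ∂r = ∫ z, z ^ k ∂r') : r = r' := by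
  refine ext_of_forall_integral_eq_of_IsFiniteMeasure fun f => ?_
  obtain ⟨P, hP⟩ := poly_lim f.continuous
  refine tendsto_nhds_unique (hP r inferInstance hr) ?_
  refine (hP r' inferInstance hr').congr fun n => ?_
  rw [poly_integral _ _ hr, poly_integral _ _ hr']
  simp only [h]

lemma measurable_of_moments {r : ℝ → Measure ℝ} (hf : ∀ t, IsFiniteMeasure (r t))
    (hr : ∀ t, r t (Icc 0 1)ᶜ = 0)
    (h : ∀ k : ℕ, Measurable (fun t => ∫ z, z ^ k ∂(r t))) : Measurable r := by
  have h1 : ∀ f : ℝ → ℝ, Continuous f → Measurable (fun t => ∫ z, f z ∂(r t)) := by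
    intro f hfc
    obtain ⟨P, hP⟩ := poly_lim hfc
    refine measurable_of_tendsto_metrizable (f := fun n t => ∫ z, (P n).eval z ∂(r t)) (fun n => ?_)
      (tendsto_pi_nhds.2 fun t => hP (r t) (hf t) (hr t))
    have : (fun t => ∫ z, (P n).eval z ∂(r t)) = fun t =>
        ∑ k ∈ Finset.range ((P n).natDegree + 1), (P n).coeff k * ∫ z, z ^ k ∂(r t) := by
      ext t
      rw [poly_integral _ _ (hr t)]
    rw [this]
    exact Finset.measurable_fun_sum _ fun k _ => (h k).const_mul _
  have h2 : ∀ F : Set ℝ, IsClosed F → Measurable (fun t => r t F) := by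
    intro F hF
    have h3 : Measurable (fun t => (r t).real F) := by
      refine measurable_of_tendsto_metrizable
        (f := fun n t => ∫ z, (thickenedIndicator (Nat.one_div_pos_of_nat (α := ℝ) (n := n)) F z : ℝ) ∂(r t))
        (fun n => ?_)
        (tendsto_pi_nhds.2 fun t => ?_)
      · exact h1 _ (NNReal.continuous_coe.comp (thickenedIndicator _ F).continuous)
      · exact tendsto_integral_thickenedIndicator_of_isClosed (r t) hF
          (fun n => Nat.one_div_pos_of_nat) tendsto_one_div_add_atTop_nhds_zero_nat
    have h4 : (fun t => r t F) = fun t => ENNReal.ofReal ((r t).real F) := by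
      ext t; rw [ofReal_measureReal]
    rw [h4]; exact h3.ennreal_ofReal
  exact Measurable.measure_of_isPiSystem
    ((BorelSpace.measurable_eq (α := ℝ)).trans borel_eq_generateFrom_isClosed) isPiSystem_isClosed
    (fun s hs => h2 s hs) (h2 _ isClosed_univ)

def ww (x : ℝ) : ENNReal := ENNReal.ofReal (x * (1 - exp (-x)))
lemma ww_meas : Measurable ww := by unfold ww; fun_prop

def enc (ν : Measure ℝ) : Measure ℝ := (ν.withDensity ww).map (fun x => exp (-x))
def dec (r : Measure ℝ) : Measure ℝ := (r.map (fun z => -Real.log z)).withDensity (fun x => (ww x)⁻¹)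

namespace GoodM
variable {ν : Measure ℝ}

lemma dec_enc (h : GoodM ν) : dec (enc ν) = ν := by
  unfold dec enc
  rw [Measure.map_map (g := fun z : ℝ => -Real.log z) Real.measurable_log.neg (by fun_prop)]
  have : ((fun z => -Real.log z) ∘ fun x => exp (-x)) = id := by
    ext x; simp
  rw [this, Measure.map_id]
  refine withDensity_inv_same ww_meas ?_ ?_
  · filter_upwards [h.ae_pos] with x hx
    have h1 : exp (-x) < 1 := exp_lt_one_iff.2 (by linarith)
    have : 0 < x * (1 - exp (-x)) := mul_pos hx (by linarith)
    simpa [ww] using this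
  · filter_upwards with x; simp [ww]

lemma enc_finite (h : GoodM ν) : IsFiniteMeasure (enc ν) := by
  have : IsFiniteMeasure (ν.withDensity ww) := by
    refine isFiniteMeasure_withDensity_ofReal ?_
    have := (h.intU zero_le_one).2
    simpa using this
  unfold enc; infer_instance

lemma enc_supp (h : GoodM ν) : enc ν (Icc 0 1)ᶜ = 0 := by
  unfold enc
  rw [Measure.map_apply (by fun_prop) measurableSet_Icc.compl]
  refine withDensity_absolutelyContinuous _ _ ?_
  refine measure_mono_null ?_ (ae_iff.1 h.ae_pos)
  intro x hx hx0
  exact hx ⟨(exp_pos _).le, exp_le_one_iff.2 (by linarith)⟩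

lemma enc_moment (h : GoodM ν) (k : ℕ) : ∫ z, z ^ k ∂(enc ν) = LU ν (k + 1) - LU ν k := by
  unfold enc
  rw [integral_map (by fun_prop) (by fun_prop),
    integral_withDensity_eq_integral_toReal_smul ww_meas (by filter_upwards with x; simp [ww]),
    LU, LU, ← integral_sub (h.intU (by positivity)) (h.intU (by positivity))]
  refine integral_congr_ae ?_
  filter_upwards [h.ae_pos] with x hx
  have h1 : exp (-x) < 1 := exp_lt_one_iff.2 (by linarith)
  have : 0 < x * (1 - exp (-x)) := mul_pos hx (by linarith)
  simp only [ww, smul_eq_mul]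
  rw [ENNReal.toReal_ofReal this.le, ← exp_nat_mul]
  have e1 : exp (-((k:ℝ) + 1) * x) = exp (k * -x) * exp (-x) := by rw [← exp_add]; ring_nf
  have e2 : exp (-(k:ℝ) * x) = exp (k * -x) := by ring_nf
  rw [e1, e2]; ring

theorem ext_LU {ρ : Measure ℝ} (h : GoodM ν) (h' : GoodM ρ) (hU : ∀ s, 0 < s → LU ν s = LU ρ s) :
    ν = ρ := by
  have hU' : ∀ s, 0 ≤ s → LU ν s = LU ρ s := by
    intro s hs
    rcases hs.eq_or_lt with rfl | hs
    · rw [LU_zero, LU_zero]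
    · exact hU s hs
  rw [← h.dec_enc, ← h'.dec_enc]
  have := h.enc_finite
  have := h'.enc_finite
  congr 1
  refine ext_of_moments h.enc_supp h'.enc_supp fun k => ?_
  rw [h.enc_moment, h'.enc_moment, hU' _ (by positivity), hU' _ (by positivity)]

end GoodM

lemma measurable_dec : Measurable dec := by
  refine Measure.measurable_of_measurable_coe _ fun s hs => ?_
  unfold dec
  simp only [withDensity_apply _ hs, ← lintegral_indicator hs]
  exact (Measure.measurable_lintegral (Measurable.indicator ww_meas.inv hs)).comp
    (Measure.measurable_map _ Real.measurable_log.neg)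

theorem measurable_family {ν : ℝ → Measure ℝ} (h : ∀ t, GoodM (ν t))
    (hU : ∀ s, 0 < s → Measurable (fun t => LU (ν t) s)) : Measurable ν := by
  have hU' : ∀ s, 0 ≤ s → Measurable (fun t => LU (ν t) s) := by
    intro s hs
    rcases hs.eq_or_lt with rfl | hs
    · simp only [GoodM.LU_zero]; exact measurable_const
    · exact hU s hs
  have h1 : Measurable (fun t => enc (ν t)) := by
    refine measurable_of_moments (fun t => (h t).enc_finite) (fun t => (h t).enc_supp) fun k => ?_
    simp only [(h _).enc_moment]
    exact (hU' _ (by positivity)).sub (hU' _ (by positivity))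
  have h2 : ν = fun t => dec (enc (ν t)) := by ext1 t; rw [(h t).dec_enc]
  rw [h2]
  exact measurable_dec.comp h1

lemma mvt_zero {φ φ' : ℝ → ℝ} {x C l : ℝ} (hx : 0 < x)
    (hd : ∀ y, 0 < y → y ≤ x → HasDerivAt φ (φ' y) y)
    (hC : ∀ y, 0 < y → y ≤ x → |φ' y| ≤ C) (hl : Tendsto φ (𝓝[>] 0) (𝓝 l)) :
    |φ x - l| ≤ C * x := by
  have h1 : ∀ a, 0 < a → a < x → |φ x - φ a| ≤ C * (x - a) := by
    intro a ha hax
    have := (convex_Icc a x).norm_image_sub_le_of_norm_hasDerivWithin_le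
      (f := φ) (f' := φ') (C := C)
      (fun y hy => (hd y (ha.trans_le hy.1) hy.2).hasDerivWithinAt)
      (fun y hy => hC y (ha.trans_le hy.1) hy.2) (left_mem_Icc.2 hax.le) (right_mem_Icc.2 hax.le)
    rwa [Real.norm_eq_abs, Real.norm_eq_abs, abs_of_pos (sub_pos.2 hax)] at this
  have h2 : Tendsto (fun a => |φ x - φ a|) (𝓝[>] 0) (𝓝 |φ x - l|) := (tendsto_const_nhds.sub hl).abs
  have h3 : Tendsto (fun a : ℝ => C * (x - a)) (𝓝[>] 0) (𝓝 (C * x)) := by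
    have : Tendsto (fun a : ℝ => C * (x - a)) (𝓝 0) (𝓝 (C * (x - 0))) :=
      (by fun_prop : Continuous fun a : ℝ => C * (x - a)).tendsto 0
    rw [sub_zero] at this
    exact this.mono_left nhdsWithin_le_nhds
  refine le_of_tendsto_of_tendsto h2 h3 ?_
  filter_upwards [Ioo_mem_nhdsGT hx] with a ha using h1 a ha.1 ha.2

/-- `r` is controlled by its second derivative -/
structure QB (r : ℝ → ℝ) (A : ℝ) : Prop where
  cont : ContinuousOn r (Ioi 0)
  sq : ∀ x, 0 < x → |r x| ≤ A * x ^ 2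
  mix : ∀ x y, 0 < x → 0 < y → |r (x + y) - r x - r y| ≤ A * (x * y)

lemma QB_of {r r1 r2 : ℝ → ℝ} {A : ℝ} (h1 : ∀ x, 0 < x → HasDerivAt r (r1 x) x)
    (h2 : ∀ x, 0 < x → HasDerivAt r1 (r2 x) x) (hA : ∀ x, 0 < x → |r2 x| ≤ A)
    (l0 : Tendsto r (𝓝[>] 0) (𝓝 0)) (l1 : Tendsto r1 (𝓝[>] 0) (𝓝 0)) : QB r A := by
  have hA0 : 0 ≤ A := (abs_nonneg _).trans (hA 1 one_pos)
  have b1 : ∀ x, 0 < x → |r1 x| ≤ A * x := by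
    intro x hx
    have := mvt_zero hx (fun y hy _ => h2 y hy) (fun y hy _ => hA y hy) l1
    rwa [sub_zero] at this
  refine ⟨fun x hx => (h1 x hx).continuousAt.continuousWithinAt, ?_, ?_⟩
  · intro x hx
    have := mvt_zero hx (fun y hy _ => h1 y hy) (C := A * x)
      (fun y hy hyx => (b1 y hy).trans (mul_le_mul_of_nonneg_left hyx hA0)) l0
    rw [sub_zero] at this
    linarith [this, sq x, mul_assoc A x x]
  · intro x y hx hy
    have hl : Tendsto (fun y => r (x + y) - r y) (𝓝[>] 0) (𝓝 (r x - 0)) := by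
      refine Tendsto.sub ?_ l0
      have : Tendsto (fun y => r (x + y)) (𝓝 0) (𝓝 (r x)) := by
        have hc : ContinuousAt (fun y => r (x + y)) 0 := by
          refine ContinuousAt.comp (f := fun y => x + y) (g := r) ?_ (by fun_prop)
          simpa using (h1 x hx).continuousAt
        simpa using hc.tendsto
      exact this.mono_left nhdsWithin_le_nhds
    have := mvt_zero (φ := fun y => r (x + y) - r y) (φ' := fun y => r1 (x + y) - r1 y) hy (C := A * x)
      (fun z hz _ => ((h1 (x + z) (by linarith)).comp_const_add x z).sub (h1 z hz))
      (fun z hz _ => by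
        have := (convex_Ioi (0:ℝ)).norm_image_sub_le_of_norm_hasDerivWithin_le
          (f := r1) (f' := r2) (C := A)
          (fun y hy => (h2 y hy).hasDerivWithinAt) (fun y hy => hA y hy)
          (show z ∈ Ioi (0:ℝ) from hz) (show x + z ∈ Ioi (0:ℝ) from by simp; linarith)
        simpa [abs_of_pos hx] using this) hl
    rw [sub_zero] at this
    have e : r (x + y) - r x - r y = r (x + y) - r y - r x := by ring
    rw [e]
    linarith [mul_assoc A x y]

def Wf (f : ℝ → ℝ) (p : ℝ × ℝ) : ℝ := (f (p.1 + p.2) - f p.1 - f p.2) * (p.1 * p.2)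

namespace GoodM
variable {ν : Measure ℝ}

lemma restrict_prod (h : GoodM ν) :
    (ν.prod ν).restrict (Ioi 0 ×ˢ Ioi 0) = ν.prod ν := by
  have := h.sfinite
  rw [← Measure.prod_restrict, restrict_of_null h.1]

lemma ae_prod (h : GoodM ν) : ∀ᵐ p ∂(ν.prod ν), 0 < p.1 ∧ 0 < p.2 := by
  rw [← h.restrict_prod]
  filter_upwards [ae_restrict_mem (measurableSet_Ioi.prod measurableSet_Ioi)] with p hp using hp

lemma pairing_eq (h : GoodM ν) (f : ℝ → ℝ) :
    coagPairing (fun x y => x * y) ν f = 1 / 2 * ∫ p, Wf f p ∂(ν.prod ν) := by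
  unfold coagPairing; rw [h.restrict_prod]; rfl

lemma sq_prod_int (h : GoodM ν) : Integrable (fun p : ℝ × ℝ => p.1 ^ 2 * p.2 ^ 2) (ν.prod ν) := by
  have := h.sfinite
  exact h.2.mul_prod h.2

lemma sq_prod_eq (h : GoodM ν) : ∫ p : ℝ × ℝ, p.1 ^ 2 * p.2 ^ 2 ∂(ν.prod ν) = M2 ν ^ 2 := by
  have := h.sfinite
  rw [integral_prod_mul (fun x : ℝ => x ^ 2) (fun x : ℝ => x ^ 2), sq]; rfl

lemma Wf_meas (h : GoodM ν) {f : ℝ → ℝ} (hf : ContinuousOn f (Ioi 0)) :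
    AEStronglyMeasurable (Wf f) (ν.prod ν) := by
  rw [← h.restrict_prod]
  refine ContinuousOn.aestronglyMeasurable ?_ (measurableSet_Ioi.prod measurableSet_Ioi)
  unfold Wf
  refine ContinuousOn.mul (ContinuousOn.sub (ContinuousOn.sub ?_ ?_) ?_) (by fun_prop)
  · refine hf.comp (by fun_prop) ?_
    rintro p ⟨hp1, hp2⟩
    exact add_pos (mem_Ioi.1 hp1) (mem_Ioi.1 hp2)
  · exact hf.comp (by fun_prop) (fun p hp => hp.1)
  · exact hf.comp (by fun_prop) (fun p hp => hp.2)

lemma Wf_bound {f : ℝ → ℝ} {A : ℝ} (hf : QB f A) {p : ℝ × ℝ} (hp : 0 < p.1 ∧ 0 < p.2) :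
    |Wf f p| ≤ A * (p.1 ^ 2 * p.2 ^ 2) := by
  unfold Wf
  rw [abs_mul, abs_of_pos (mul_pos hp.1 hp.2)]
  have := mul_le_mul_of_nonneg_right (hf.mix _ _ hp.1 hp.2) (mul_pos hp.1 hp.2).le
  refine this.trans (le_of_eq (by ring))

lemma Wf_int (h : GoodM ν) {f : ℝ → ℝ} {A : ℝ} (hf : QB f A) : Integrable (Wf f) (ν.prod ν) := by
  refine Integrable.mono' (h.sq_prod_int.const_mul A) (h.Wf_meas hf.cont) ?_
  filter_upwards [h.ae_prod] with p hp using Wf_bound hf hp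

lemma pairing_bound (h : GoodM ν) {f : ℝ → ℝ} {A : ℝ} (hf : QB f A) :
    |coagPairing (fun x y => x * y) ν f| ≤ 1 / 2 * (A * M2 ν ^ 2) := by
  rw [h.pairing_eq, abs_mul, abs_of_pos (by norm_num : (0:ℝ) < 1 / 2), ← h.sq_prod_eq,
    ← integral_const_mul]
  refine mul_le_mul_of_nonneg_left ?_ (by norm_num)
  rw [← Real.norm_eq_abs]
  refine norm_integral_le_of_norm_le (h.sq_prod_int.const_mul A) ?_
  filter_upwards [h.ae_prod] with p hp using Wf_bound hf hp

lemma int_QB (h : GoodM ν) {f : ℝ → ℝ} {A : ℝ} (hf : QB f A) : Integrable f ν := by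
  refine h.integrable ?_ A hf.sq
  rw [← restrict_of_null h.1]
  exact hf.cont.aestronglyMeasurable measurableSet_Ioi

lemma pairing_sub (h : GoodM ν) {f g : ℝ → ℝ} {A B : ℝ} (hf : QB f A) (hg : QB g B) :
    coagPairing (fun x y => x * y) ν (fun x => f x - g x) =
      coagPairing (fun x y => x * y) ν f - coagPairing (fun x y => x * y) ν g := by
  rw [h.pairing_eq, h.pairing_eq, h.pairing_eq, ← mul_sub, ← integral_sub (h.Wf_int hf) (h.Wf_int hg)]
  congr 2
  ext p; unfold Wf; ring

end GoodM

def ee (s x : ℝ) : ℝ := exp (-s * x) - 1 + s * x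

lemma Wf_ee (s : ℝ) (p : ℝ × ℝ) :
    Wf (ee s) p = (p.1 * (1 - exp (-s * p.1))) * (p.2 * (1 - exp (-s * p.2))) := by
  unfold Wf ee
  have : exp (-s * (p.1 + p.2)) = exp (-s * p.1) * exp (-s * p.2) := by rw [← exp_add]; ring_nf
  rw [this]; ring

def pe (c : ℕ → ℝ) (N : ℕ) (x : ℝ) : ℝ := ∑ k ∈ Finset.range N, c k * ee ((k:ℝ) + 1) x
def pe1 (c : ℕ → ℝ) (N : ℕ) (x : ℝ) : ℝ :=
  ∑ k ∈ Finset.range N, c k * (-((k:ℝ) + 1) * exp (-((k:ℝ) + 1) * x) + ((k:ℝ) + 1))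
def pe2 (c : ℕ → ℝ) (N : ℕ) (x : ℝ) : ℝ :=
  ∑ k ∈ Finset.range N, c k * (((k:ℝ) + 1) ^ 2 * exp (-((k:ℝ) + 1) * x))

lemma hd_exp (s x : ℝ) : HasDerivAt (fun x => exp (-s * x)) (-s * exp (-s * x)) x := by
  have h1 : HasDerivAt (fun x : ℝ => -s * x) (-s) x := by
    simpa using (hasDerivAt_id x).const_mul (-s)
  have := h1.exp
  rwa [mul_comm] at this

lemma pe_d1 (c : ℕ → ℝ) (N : ℕ) (x : ℝ) : HasDerivAt (pe c N) (pe1 c N x) x := by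
  unfold pe pe1
  refine HasDerivAt.fun_sum fun k _ => HasDerivAt.const_mul _ ?_
  unfold ee
  have h2 : HasDerivAt (fun x : ℝ => ((k:ℝ) + 1) * x) ((k:ℝ) + 1) x := by
    simpa using (hasDerivAt_id x).const_mul ((k:ℝ) + 1)
  exact ((hd_exp _ x).sub_const 1).add h2

lemma pe_d2 (c : ℕ → ℝ) (N : ℕ) (x : ℝ) : HasDerivAt (pe1 c N) (pe2 c N x) x := by
  unfold pe1 pe2
  refine HasDerivAt.fun_sum fun k _ => HasDerivAt.const_mul _ ?_
  have := ((hd_exp ((k:ℝ) + 1) x).const_mul (-((k:ℝ) + 1))).add_const ((k:ℝ) + 1)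
  have e : ((k:ℝ) + 1) ^ 2 * exp (-((k:ℝ) + 1) * x) =
    -((k:ℝ) + 1) * (-((k:ℝ) + 1) * exp (-((k:ℝ) + 1) * x)) := by ring
  rw [e]; exact this

lemma pe_zero (c : ℕ → ℝ) (N : ℕ) : pe c N 0 = 0 := by simp [pe, ee]
lemma pe1_zero (c : ℕ → ℝ) (N : ℕ) : pe1 c N 0 = 0 := by simp [pe1]

lemma pe_l0 (c : ℕ → ℝ) (N : ℕ) : Tendsto (pe c N) (𝓝[>] 0) (𝓝 0) := by
  have := (pe_d1 c N 0).continuousAt.tendsto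
  rw [pe_zero] at this
  exact this.mono_left nhdsWithin_le_nhds

lemma pe1_l0 (c : ℕ → ℝ) (N : ℕ) : Tendsto (pe1 c N) (𝓝[>] 0) (𝓝 0) := by
  have := (pe_d2 c N 0).continuousAt.tendsto
  rw [pe1_zero] at this
  exact this.mono_left nhdsWithin_le_nhds

lemma exists_pe {g : ℝ → ℝ} (hg : ContinuousOn g (Ioi 0)) {a : ℝ}
    (ha : Tendsto g (𝓝[>] 0) (𝓝 a)) (hb : Tendsto g atTop (𝓝 0)) {ε : ℝ} (hε : 0 < ε) :
    ∃ c N, ∀ x, 0 < x → |g x - pe2 c N x| ≤ ε := by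
  obtain ⟨P, hP0, hP⟩ := exp_poly_approx hg ha hb (half_pos hε)
  refine ⟨fun k => P.coeff (k + 1) / ((k:ℝ) + 1) ^ 2, P.natDegree, fun x hx => ?_⟩
  have e : pe2 (fun k => P.coeff (k + 1) / ((k:ℝ) + 1) ^ 2) P.natDegree x =
      P.eval (exp (-x)) - P.eval 0 := by
    rw [Polynomial.eval_eq_sum_range, Finset.sum_range_succ', ← Polynomial.coeff_zero_eq_eval_zero]
    simp only [pow_zero, mul_one, add_sub_cancel_right]
    unfold pe2
    refine Finset.sum_congr rfl fun k _ => ?_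
    have e2 : exp (-((k:ℝ) + 1) * x) = exp (-x) ^ (k + 1) := by
      rw [← exp_nat_mul]; push_cast; ring_nf
    have : ((k:ℝ) + 1) ^ 2 ≠ 0 := by positivity
    rw [e2]; field_simp
  rw [e]
  have h1 := hP x hx
  rw [sub_zero] at hP0
  have : g x - (P.eval (exp (-x)) - P.eval 0) = -(P.eval (exp (-x)) - g x) + P.eval 0 := by ring
  rw [this]
  refine (abs_add_le _ _).trans ?_
  rw [abs_neg]; linarith

lemma MemE2.f2_zero {f : ℝ → ℝ} (hf : MemE2 f) : Tendsto (deriv (deriv f)) atTop (𝓝 0) := by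
  obtain ⟨_, _, _, _, _, _, _, _, _, _, _, C, α, hα, hb⟩ := hf
  have h1 : Tendsto (fun x => C * exp (-α * x)) atTop (𝓝 0) := by
    have : Tendsto (fun x => exp (-α * x)) atTop (𝓝 0) := by
      refine Real.tendsto_exp_atBot.comp ?_
      exact tendsto_id.const_mul_atTop_of_neg (by linarith)
    simpa using this.const_mul C
  refine squeeze_zero_norm' ?_ h1
  filter_upwards [eventually_gt_atTop 0] with x hx
  rw [Real.norm_eq_abs]
  linarith [hb x hx, abs_nonneg (deriv f x)]

lemma MemE2.qb {f : ℝ → ℝ} (hf : MemE2 f) : ∃ A, QB f A := by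
  obtain ⟨h1, h2, _, _, _, l0, l1, _, _, _, _, C, α, hα, hb⟩ := hf
  refine ⟨|C|, QB_of h1 h2 (fun x hx => ?_) l0 l1⟩
  have := hb x hx
  have h3 : exp (-α * x) ≤ 1 := exp_le_one_iff.2 (by nlinarith [mul_pos hα hx])
  have h4 : C * exp (-α * x) ≤ |C| * 1 :=
    mul_le_mul (le_abs_self C) h3 (exp_pos _).le (abs_nonneg _)
  linarith [abs_nonneg (deriv f x)]

lemma MemE2.approx {f : ℝ → ℝ} (hf : MemE2 f) {ε : ℝ} (hε : 0 < ε) :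
    ∃ c N, QB (fun x => f x - pe c N x) ε := by
  have hz := hf.f2_zero
  obtain ⟨h1, h2, _, _, c2, l0, l1, ⟨a, l2⟩, _⟩ := hf
  obtain ⟨c, N, hcN⟩ := exists_pe c2 l2 hz hε
  refine ⟨c, N, QB_of (r1 := fun x => deriv f x - pe1 c N x) (r2 := fun x => deriv (deriv f) x - pe2 c N x)
    (fun x hx => (h1 x hx).sub (pe_d1 c N x)) (fun x hx => (h2 x hx).sub (pe_d2 c N x)) hcN ?_ ?_⟩
  · simpa using l0.sub (pe_l0 c N)
  · simpa using l1.sub (pe1_l0 c N)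

lemma pe_qb (c : ℕ → ℝ) (N : ℕ) : ∃ A, QB (pe c N) A := by
  refine ⟨∑ k ∈ Finset.range N, |c k| * ((k:ℝ) + 1) ^ 2, QB_of (fun x _ => pe_d1 c N x)
    (fun x _ => pe_d2 c N x) (fun x hx => ?_) (pe_l0 c N) (pe1_l0 c N)⟩
  unfold pe2
  refine (Finset.abs_sum_le_sum_abs _ _).trans (Finset.sum_le_sum fun k _ => ?_)
  have h3 : exp (-((k:ℝ) + 1) * x) ≤ 1 := exp_le_one_iff.2 (by
    have : 0 < ((k:ℝ) + 1) * x := by positivity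
    linarith)
  rw [abs_mul, abs_of_nonneg (show 0 ≤ ((k:ℝ) + 1) ^ 2 * exp (-((k:ℝ) + 1) * x) by positivity)]
  refine mul_le_mul_of_nonneg_left ?_ (abs_nonneg _)
  exact mul_le_of_le_one_right (by positivity) h3

namespace GoodM
variable {ν : Measure ℝ}

lemma pairing_pe (h : GoodM ν) (c : ℕ → ℝ) (N : ℕ) :
    coagPairing (fun x y => x * y) ν (pe c N) =
      ∑ k ∈ Finset.range N, c k * (LU ν ((k:ℝ) + 1) ^ 2 / 2) := by
  have := h.sfinite
  rw [h.pairing_eq]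
  have e : Wf (pe c N) = fun p => ∑ k ∈ Finset.range N, c k *
      ((p.1 * (1 - exp (-((k:ℝ) + 1) * p.1))) * (p.2 * (1 - exp (-((k:ℝ) + 1) * p.2)))) := by
    ext p
    simp only [← Wf_ee]
    simp only [Wf, pe, ← Finset.sum_sub_distrib, Finset.sum_mul]
    refine Finset.sum_congr rfl fun k _ => by ring
  rw [e, integral_finsetSum]
  · rw [Finset.mul_sum]
    refine Finset.sum_congr rfl fun k _ => ?_
    rw [integral_const_mul, integral_prod_mul (fun x => x * (1 - exp (-((k:ℝ) + 1) * x)))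
      (fun x => x * (1 - exp (-((k:ℝ) + 1) * x)))]
    unfold LU; ring
  · intro k _
    exact ((h.intU (by positivity)).mul_prod (h.intU (by positivity))).const_mul _

lemma int_pe (h : GoodM ν) (c : ℕ → ℝ) (N : ℕ) :
    ∫ x, pe c N x ∂ν = ∑ k ∈ Finset.range N, c k * LP ν ((k:ℝ) + 1) := by
  unfold pe
  rw [integral_finsetSum]
  · refine Finset.sum_congr rfl fun k _ => ?_
    rw [integral_const_mul]; rfl
  · intro k _
    exact (h.intP (by positivity)).const_mul _

end GoodM

lemma tendsto_of_abs_le {u : ℕ → ℝ} {l C : ℝ} (h : ∀ n : ℕ, |l - u n| ≤ 1 / ((n:ℝ) + 1) * C) :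
    Tendsto u atTop (𝓝 l) := by
  rw [tendsto_iff_dist_tendsto_zero]
  refine squeeze_zero (fun _ => dist_nonneg) (fun n => ?_)
    (show Tendsto (fun n : ℕ => 1 / ((n:ℝ) + 1) * C) atTop (𝓝 0) by
      simpa using (tendsto_one_div_add_atTop_nhds_zero_nat (𝕜 := ℝ)).mul_const C)
  rw [dist_comm, Real.dist_eq]; exact h n

theorem weak_form {ν₀ : Measure ℝ} (h0 : GoodM ν₀) (hM : 0 < M2 ν₀) {t : ℝ} (ht : 0 ≤ t)
    (htm : t * M2 ν₀ < 1) {ν : ℝ → Measure ℝ} {M : ℝ}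
    (hν : ∀ τ ∈ Icc 0 t, GoodM (ν τ) ∧ (∀ s, 0 < s → LU (ν τ) s = Qu ν₀ τ s) ∧ M2 (ν τ) ≤ M)
    {f : ℝ → ℝ} (hf : MemE2 f) :
    ∫ x, f x ∂(ν t) = ∫ x, f x ∂ν₀ + ∫ τ in (0:ℝ)..t, coagPairing (fun x y => x * y) (ν τ) f := by
  obtain ⟨A, hA⟩ := hf.qb
  have hτm : ∀ τ ∈ Icc 0 t, τ * M2 ν₀ < 1 := fun τ hτ =>
    lt_of_le_of_lt (mul_le_mul_of_nonneg_right hτ.2 hM.le) htm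
  choose c N hcN using fun n : ℕ => hf.approx (ε := 1 / ((n:ℝ) + 1)) (by positivity)
  choose B hB using fun n : ℕ => pe_qb (c n) (N n)
  obtain ⟨ht1, ht2, ht3⟩ := hν t (right_mem_Icc.2 ht)
  have hIntg : ∀ ρ, GoodM ρ → Tendsto (fun n => ∫ x, pe (c n) (N n) x ∂ρ) atTop (𝓝 (∫ x, f x ∂ρ)) := by
    intro ρ hρ
    refine tendsto_of_abs_le (C := M2 ρ) fun n => ?_
    rw [← integral_sub (hρ.int_QB hA) (hρ.int_QB (hB n))]
    exact hρ.abs_integral_le _ (hcN n).sq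
  let F : ℕ → ℝ → ℝ := fun n τ => ∑ k ∈ Finset.range (N n), c n k * (Qu ν₀ τ ((k:ℝ) + 1) ^ 2 / 2)
  have hF : ∀ n, ∀ τ ∈ Icc 0 t, F n τ = coagPairing (fun x y => x * y) (ν τ) (pe (c n) (N n)) := by
    intro n τ hτ
    obtain ⟨a1, a2, a3⟩ := hν τ hτ
    rw [a1.pairing_pe]
    refine Finset.sum_congr rfl fun k _ => ?_
    rw [a2 _ (by positivity)]
  have hcontQ : ∀ s, 0 < s → ContinuousOn (fun τ => Qu ν₀ τ s) (Icc 0 t) := fun s hs =>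
    (h0.contOn_Qu_t hs.le).mono fun τ hτ => ⟨hτ.1, hτm τ hτ⟩
  have hcontQ2 : ∀ s, 0 < s → ContinuousOn (fun τ => Qu ν₀ τ s ^ 2 / 2) (Icc 0 t) := fun s hs =>
    ((hcontQ s hs).pow 2).div_const 2
  have hQi : ∀ s, 0 < s → IntervalIntegrable (fun τ => Qu ν₀ τ s ^ 2 / 2) volume 0 t := fun s hs =>
    ContinuousOn.intervalIntegrable (by rw [uIcc_of_le ht]; exact hcontQ2 s hs)
  have hFc : ∀ n, ContinuousOn (F n) (Icc 0 t) := fun n =>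
    continuousOn_finset_sum _ fun k _ => (hcontQ2 _ (by positivity)).const_smul (c n k)
  have hdiff : ∀ n, ∀ τ ∈ Icc 0 t, |coagPairing (fun x y => x * y) (ν τ) f - F n τ| ≤
      1 / ((n:ℝ) + 1) * (1 / 2 * M ^ 2) := by
    intro n τ hτ
    obtain ⟨a1, a2, a3⟩ := hν τ hτ
    rw [hF n τ hτ, ← a1.pairing_sub hA (hB n)]
    refine (a1.pairing_bound (hcN n)).trans ?_
    have : M2 (ν τ) ^ 2 ≤ M ^ 2 := pow_le_pow_left₀ GoodM.M2_nonneg a3 2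
    have h3 : (0:ℝ) < 1 / ((n:ℝ) + 1) := by positivity
    nlinarith
  have hlimF : Tendsto (fun n => ∫ τ in (0:ℝ)..t, F n τ) atTop
      (𝓝 (∫ τ in (0:ℝ)..t, coagPairing (fun x y => x * y) (ν τ) f)) := by
    refine intervalIntegral.tendsto_integral_filter_of_dominated_convergence
      (fun _ => 1 / 2 * (|A| * M ^ 2) + 1 / 2 * M ^ 2) ?_ ?_ intervalIntegrable_const ?_
    · filter_upwards with n
      rw [uIoc_of_le ht]
      exact ((hFc n).mono Ioc_subset_Icc_self).aestronglyMeasurable measurableSet_Ioc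
    · filter_upwards with n
      filter_upwards with τ hτ
      rw [uIoc_of_le ht] at hτ
      have hτ' := Ioc_subset_Icc_self hτ
      obtain ⟨a1, a2, a3⟩ := hν τ hτ'
      have b1 := hdiff n τ hτ'
      have b2 := a1.pairing_bound hA
      have b3 : M2 (ν τ) ^ 2 ≤ M ^ 2 := pow_le_pow_left₀ GoodM.M2_nonneg a3 2
      have b4 : A * M2 (ν τ) ^ 2 ≤ |A| * M ^ 2 :=
        mul_le_mul (le_abs_self A) b3 (sq_nonneg _) (abs_nonneg _)
      have b5 : 1 / ((n:ℝ) + 1) ≤ 1 := by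
        rw [div_le_one (by positivity)]; linarith [n.cast_nonneg (α := ℝ)]
      have b6 : 1 / ((n:ℝ) + 1) * (1 / 2 * M ^ 2) ≤ 1 * (1 / 2 * M ^ 2) :=
        mul_le_mul_of_nonneg_right b5 (by positivity)
      rw [Real.norm_eq_abs]
      rw [abs_sub_comm] at b1
      have b7 := abs_sub_abs_le_abs_sub (F n τ) (coagPairing (fun x y => x * y) (ν τ) f)
      linarith
    · filter_upwards with τ hτ
      rw [uIoc_of_le ht] at hτ
      exact tendsto_of_abs_le fun n => hdiff n τ (Ioc_subset_Icc_self hτ)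
  refine tendsto_nhds_unique (hIntg _ ht1) (((hIntg ν₀ h0).add hlimF).congr fun n => ?_)
  rw [h0.int_pe, ht1.int_pe, intervalIntegral.integral_finsetSum (fun k _ => (hQi _ (by positivity)).const_mul _),
    ← Finset.sum_add_distrib]
  refine Finset.sum_congr rfl fun k _ => ?_
  have hk : (0:ℝ) < (k:ℝ) + 1 := by positivity
  rw [intervalIntegral.integral_const_mul, h0.LP_eq_PP ht1 ht htm ht2 hk,
    h0.PP_eq_integral hM ht htm hk]
  ring

lemma joint_cont {G : ℝ → ℝ → ℝ} {t c L : ℝ} (hL : 0 ≤ L)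
    (h1 : ∀ σ, c < σ → ContinuousOn (fun r => G r σ) (Icc 0 t))
    (h2 : ∀ r ∈ Icc 0 t, ∀ a b, c < a → c < b → |G r a - G r b| ≤ L * |a - b|) :
    ContinuousOn (fun p : ℝ × ℝ => G p.1 p.2) (Icc 0 t ×ˢ Ioi c) := by
  refine continuousOn_prod_of_continuousOn_lipschitzOnWith' (fun p : ℝ × ℝ => G p.1 p.2) L.toNNReal
    (fun r hr => ?_) (fun σ hσ => h1 σ hσ)
  refine LipschitzOnWith.of_dist_le_mul fun a ha b hb => ?_
  rw [Real.dist_eq, Real.dist_eq, Real.coe_toNNReal _ hL]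
  exact h2 r hr a b ha hb

lemma span_eq (c : ℝ) : ContinuousLinearMap.toSpanSingleton ℝ c = c • (1 : ℝ →L[ℝ] ℝ) := by
  ext; simp

theorem char_unique {U F : ℝ → ℝ → ℝ} {U0 : ℝ → ℝ} {t B s0 p : ℝ} (ht : 0 ≤ t) (hB : 0 ≤ B)
    (hUs : ∀ r ∈ Icc 0 t, ∀ σ, 0 < σ → HasDerivAt (U r) (F r σ) σ)
    (hF : ∀ r ∈ Icc 0 t, ∀ σ, 0 < σ → 0 ≤ F r σ ∧ F r σ ≤ B)
    (hFlip : ∀ r ∈ Icc 0 t, ∀ c a b, 0 < c → c ≤ a → c ≤ b → |F r a - F r b| ≤ (1 / c * |a - b|) * B)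
    (heq : ∀ r ∈ Icc 0 t, ∀ σ, 0 < σ → U r σ = U0 σ + ∫ τ in (0:ℝ)..r, U τ σ * F τ σ)
    (hIntg : ∀ σ, 0 < σ → IntervalIntegrable (fun τ => U τ σ * F τ σ) volume 0 t)
    (hp0 : 0 ≤ p) (hp : p = U0 s0) (hs : 0 < s0 - t * p) : U t (s0 - t * p) = p := by
  rcases ht.eq_or_lt with rfl | htpos
  · rw [zero_mul, sub_zero] at *
    rw [heq 0 (by simp) s0 hs, hp]; simp
  have hUlip : ∀ r ∈ Icc 0 t, ∀ a b, 0 < a → 0 < b → |U r a - U r b| ≤ B * |a - b| := by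
    intro r hr a b ha hb
    have := (convex_Ioi (0:ℝ)).norm_image_sub_le_of_norm_hasDerivWithin_le
      (f := U r) (f' := F r) (C := B)
      (fun y hy => (hUs r hr y hy).hasDerivWithinAt)
      (fun y hy => by
        rw [Real.norm_eq_abs, abs_of_nonneg (hF r hr y hy).1]; exact (hF r hr y hy).2)
      (show b ∈ Ioi (0:ℝ) from hb) (show a ∈ Ioi (0:ℝ) from ha)
    simpa using this
  have hUt : ∀ σ, 0 < σ → ContinuousOn (fun r => U r σ) (Icc 0 t) := by
    intro σ hσ
    have h1 : ContinuousOn (fun r => U0 σ + ∫ τ in (0:ℝ)..r, U τ σ * F τ σ) (Icc 0 t) := by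
      refine continuousOn_const.add ?_
      have := intervalIntegral.continuousOn_primitive_interval' (hIntg σ hσ) left_mem_uIcc
      rwa [uIcc_of_le ht] at this
    exact h1.congr fun r hr => heq r hr σ hσ
  have hFt : ∀ σ, 0 < σ → ContinuousOn (fun r => F r σ) (Icc 0 t) := by
    intro σ hσ
    let h : ℕ → ℝ := fun n => 1 / ((n:ℝ) + 1)
    have hh : ∀ n, 0 < h n := fun n => by positivity
    have hu : TendstoUniformlyOn (fun n r => (U r (σ + h n) - U r σ) / h n) (fun r => F r σ) atTop
        (Icc 0 t) := by
      rw [Metric.tendstoUniformlyOn_iff]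
      intro ε hε
      have hlim : Tendsto (fun n => (1 / σ * h n) * B) atTop (𝓝 0) := by
        have := ((tendsto_one_div_add_atTop_nhds_zero_nat (𝕜 := ℝ)).const_mul (1 / σ)).mul_const B
        simpa [h] using this
      filter_upwards [hlim.eventually_lt_const hε] with n hn r hr
      obtain ⟨ξ, hξ, hξ2⟩ := exists_hasDerivAt_eq_slope (U r) (F r) (show σ < σ + h n by linarith [hh n])
        (fun x hx => (hUs r hr x (hσ.trans_le hx.1)).continuousAt.continuousWithinAt)
        (fun x hx => hUs r hr x (hσ.trans hx.1))
      rw [add_sub_cancel_left] at hξ2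
      rw [← hξ2, Real.dist_eq]
      refine lt_of_le_of_lt (hFlip r hr σ σ ξ hσ le_rfl hξ.1.le) (lt_of_le_of_lt ?_ hn)
      have : |σ - ξ| ≤ h n := by rw [abs_le]; constructor <;> linarith [hξ.1, hξ.2]
      exact mul_le_mul_of_nonneg_right (mul_le_mul_of_nonneg_left this (by positivity)) hB
    refine hu.continuousOn (Frequently.of_forall fun n => ?_)
    exact ((hUt _ (by linarith [hh n])).sub (hUt σ hσ)).div_const _
  set c := (s0 - t * p) / 2 with hc
  have hc0 : 0 < c := by linarith
  have jU : ContinuousOn (fun q : ℝ × ℝ => U q.1 q.2) (Icc 0 t ×ˢ Ioi c) :=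
    joint_cont hB (fun σ hσ => hUt σ (hc0.trans hσ))
      (fun r hr a b ha hb => hUlip r hr a b (hc0.trans ha) (hc0.trans hb))
  have jF : ContinuousOn (fun q : ℝ × ℝ => F q.1 q.2) (Icc 0 t ×ˢ Ioi c) := by
    refine joint_cont (L := 1 / c * B) (by positivity) (fun σ hσ => hFt σ (hc0.trans hσ))
      (fun r hr a b ha hb => ?_)
    refine (hFlip r hr c a b hc0 ha.le hb.le).trans (le_of_eq (by ring))
  let σ : ℝ → ℝ := fun r => s0 - r * p
  have hσ : ∀ r, r ≤ t → c < σ r := by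
    intro r hr
    have := mul_le_mul_of_nonneg_right hr hp0
    simp only [σ]; linarith
  let y : ℝ → ℝ := fun r => U r (σ r)
  have hyc : ContinuousOn y (Icc 0 t) := by
    refine jU.comp (f := fun r => (r, σ r)) (by simp only [σ]; fun_prop) (fun r hr => ⟨hr, hσ r hr.2⟩)
  have hyd : ∀ r ∈ Ioo 0 t, HasDerivAt y ((y r - p) * F r (σ r)) r := by
    intro r hr
    have hopen : Ioo 0 t ×ˢ Ioi c ∈ 𝓝 (r, σ r) :=
      prod_mem_nhds (Ioo_mem_nhds hr.1 hr.2) (Ioi_mem_nhds (hσ r hr.2.le))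
    have hsub : Ioo 0 t ×ˢ Ioi c ⊆ Icc 0 t ×ˢ Ioi c := prod_mono_left Ioo_subset_Icc_self
    have cU : ContinuousAt (fun q : ℝ × ℝ => U q.1 q.2) (r, σ r) :=
      jU.continuousAt (mem_of_superset hopen hsub)
    have cF : ContinuousAt (fun q : ℝ × ℝ => F q.1 q.2) (r, σ r) :=
      jF.continuousAt (mem_of_superset hopen hsub)
    have key := hasStrictFDerivAt_uncurry_coprod (𝕜 := ℝ) (u := (r, σ r)) (f := U)
      (f₁ := fun a b => (U a b * F a b) • (1 : ℝ →L[ℝ] ℝ)) (f₂ := fun a b => F a b • (1 : ℝ →L[ℝ] ℝ))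
      (by
        filter_upwards [hopen] with v hv
        have hv2 : 0 < v.2 := hc0.trans hv.2
        have hcont : ContinuousOn (fun τ => U τ v.2 * F τ v.2) (Icc 0 t) := (hUt _ hv2).mul (hFt _ hv2)
        have hd : HasDerivAt (fun r => U0 v.2 + ∫ τ in (0:ℝ)..r, U τ v.2 * F τ v.2)
            (U v.1 v.2 * F v.1 v.2) v.1 := by
          refine HasDerivAt.const_add _ ?_
          refine intervalIntegral.integral_hasDerivAt_right ?_ ?_ ?_
          · refine (hIntg _ hv2).mono_set ?_
            rw [uIcc_of_le ht, uIcc_of_le hv.1.1.le]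
            exact Icc_subset_Icc_right hv.1.2.le
          · exact (hcont.mono Ioo_subset_Icc_self).stronglyMeasurableAtFilter isOpen_Ioo _ hv.1
          · exact hcont.continuousAt (Icc_mem_nhds hv.1.1 hv.1.2)
        have hd2 : HasDerivAt (fun r => U r v.2) (U v.1 v.2 * F v.1 v.2) v.1 := by
          refine hd.congr_of_eventuallyEq ?_
          filter_upwards [Icc_mem_nhds hv.1.1 hv.1.2] with r hr using heq r hr _ hv2
        have := hd2.hasFDerivAt
        rw [span_eq] at this
        exact this)
      (by
        filter_upwards [hopen] with v hv
        have hv2 : 0 < v.2 := hc0.trans hv.2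
        have := (hUs v.1 ⟨hv.1.1.le, hv.1.2.le⟩ v.2 hv2).hasFDerivAt
        rw [span_eq] at this
        exact this)
      ((cU.mul cF).smul continuousAt_const) (cF.smul continuousAt_const)
    have hpath : HasDerivAt (fun r => (r, σ r)) (1, -p) r := by
      refine (hasDerivAt_id r).prodMk ?_
      have := ((hasDerivAt_id r).mul_const p).const_sub s0
      simpa using this
    have := key.hasFDerivAt.comp_hasDerivAt r hpath
    refine this.congr_deriv ?_
    simp [Function.HasUncurry.uncurry, y]
    ring
  let E : ℝ → ℝ := fun r => (y r - p) ^ 2 * exp (-(2 * B) * r)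
  have hEanti : AntitoneOn E (Icc 0 t) := by
    have hEd : ∀ r ∈ Ioo 0 t, HasDerivAt E
        (2 * (y r - p) ^ 2 * (F r (σ r) - B) * exp (-(2 * B) * r)) r := by
      intro r hr
      have h1 := (((hyd r hr).sub_const p).pow 2).mul (hd_exp (2 * B) r)
      refine h1.congr_deriv ?_
      simp only [Pi.pow_apply]
      push_cast
      ring
    refine antitoneOn_of_deriv_nonpos (convex_Icc 0 t) ?_ ?_ ?_
    · exact ((hyc.sub continuousOn_const).pow 2).mul (by fun_prop)
    · rw [interior_Icc]
      exact fun r hr => (hEd r hr).differentiableAt.differentiableWithinAt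
    · rw [interior_Icc]
      intro r hr
      rw [(hEd r hr).deriv]
      have h1 := (hF r ⟨hr.1.le, hr.2.le⟩ (σ r) (hc0.trans (hσ r hr.2.le))).2
      have h2 : 0 ≤ 2 * (y r - p) ^ 2 := by positivity
      have h3 : 2 * (y r - p) ^ 2 * (F r (σ r) - B) ≤ 0 := mul_nonpos_of_nonneg_of_nonpos h2 (by linarith)
      exact mul_nonpos_of_nonpos_of_nonneg h3 (exp_pos _).le
  have hE0 : E 0 = 0 := by
    have hs0 : 0 < s0 := by
      have := hσ 0 ht
      simp only [σ, zero_mul, sub_zero] at this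
      linarith
    have : y 0 = p := by
      simp only [y, σ, zero_mul, sub_zero]
      rw [heq 0 (left_mem_Icc.2 ht) s0 hs0, hp]; simp
    simp [E, this]
  have hEt := hEanti (left_mem_Icc.2 ht) (right_mem_Icc.2 ht) ht
  rw [hE0] at hEt
  have h1 : (y t - p) ^ 2 ≤ 0 := by
    by_contra hcon
    push Not at hcon
    have : 0 < E t := mul_pos hcon (exp_pos _)
    linarith
  have h2 : y t - p = 0 := by
    have := le_antisymm h1 (sq_nonneg _)
    exact pow_eq_zero_iff (two_ne_zero) |>.1 this
  have : U t (σ t) = p := by linarith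
  exact this

structure Nice (f f1 f2 : ℝ → ℝ) : Prop where
  d1 : ∀ x, HasDerivAt f (f1 x) x
  d2 : ∀ x, HasDerivAt f1 (f2 x) x
  c2 : Continuous f2
  bd : ∃ C α : ℝ, 0 < α ∧ ∀ x, 0 < x → |f x| ≤ C * exp (-α * x) ∧ |f1 x| ≤ C * exp (-α * x) ∧
    |f2 x| ≤ C * exp (-α * x)

lemma poly_exp_bound (P : Polynomial ℝ) {s : ℝ} (hs : 0 < s) :
    ∃ C : ℝ, ∀ x, 0 < x → |P.eval x * exp (-s * x)| ≤ C * exp (-(s / 2) * x) := by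
  induction P using Polynomial.induction_on' with
  | add p q hp hq =>
    obtain ⟨C1, h1⟩ := hp
    obtain ⟨C2, h2⟩ := hq
    refine ⟨C1 + C2, fun x hx => ?_⟩
    rw [Polynomial.eval_add, add_mul, add_mul]
    exact (abs_add_le _ _).trans (add_le_add (h1 x hx) (h2 x hx))
  | monomial n a =>
    refine ⟨|a| * ((n.factorial : ℝ) / (s / 2) ^ n), fun x hx => ?_⟩
    have h1 := Real.pow_div_factorial_le_exp (s / 2 * x) (by positivity) n
    have hf : (0:ℝ) < n.factorial := by exact_mod_cast n.factorial_pos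
    have h2 : x ^ n ≤ (n.factorial : ℝ) / (s / 2) ^ n * exp (s / 2 * x) := by
      rw [div_le_iff₀ hf, mul_pow] at h1
      rw [div_mul_eq_mul_div, le_div_iff₀ (by positivity)]
      linarith
    have e : exp (s / 2 * x) * exp (-s * x) = exp (-(s / 2) * x) := by
      rw [← exp_add]; congr 1; ring
    rw [Polynomial.eval_monomial, abs_mul, abs_mul, abs_of_pos (exp_pos _), abs_of_pos (pow_pos hx n)]
    calc |a| * x ^ n * exp (-s * x)
        ≤ |a| * ((n.factorial : ℝ) / (s / 2) ^ n * exp (s / 2 * x)) * exp (-s * x) := by gcongr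
      _ = |a| * ((n.factorial : ℝ) / (s / 2) ^ n) * (exp (s / 2 * x) * exp (-s * x)) := by ring
      _ = _ := by rw [e]

lemma poly_exp_deriv (P : Polynomial ℝ) (s x : ℝ) :
    HasDerivAt (fun x => P.eval x * exp (-s * x))
      ((Polynomial.derivative P - Polynomial.C s * P).eval x * exp (-s * x)) x := by
  refine ((P.hasDerivAt x).mul (hd_exp s x)).congr_deriv ?_
  simp only [Polynomial.eval_sub, Polynomial.eval_mul, Polynomial.eval_C]
  ring

lemma nice_poly (P : Polynomial ℝ) {s : ℝ} (hs : 0 < s) :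
    ∃ f2, Nice (fun x => P.eval x * exp (-s * x))
      (fun x => (Polynomial.derivative P - Polynomial.C s * P).eval x * exp (-s * x)) f2 := by
  set Q := Polynomial.derivative P - Polynomial.C s * P with hQ
  refine ⟨fun x => (Polynomial.derivative Q - Polynomial.C s * Q).eval x * exp (-s * x),
    poly_exp_deriv P s, poly_exp_deriv Q s, by fun_prop, ?_⟩
  obtain ⟨C1, h1⟩ := poly_exp_bound P hs
  obtain ⟨C2, h2⟩ := poly_exp_bound Q hs
  obtain ⟨C3, h3⟩ := poly_exp_bound (Polynomial.derivative Q - Polynomial.C s * Q) hs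
  refine ⟨max C1 (max C2 C3), s / 2, by linarith, fun x hx => ⟨?_, ?_, ?_⟩⟩
  · exact (h1 x hx).trans (mul_le_mul_of_nonneg_right (le_max_left _ _) (exp_pos _).le)
  · exact (h2 x hx).trans (mul_le_mul_of_nonneg_right ((le_max_left _ _).trans (le_max_right _ _)) (exp_pos _).le)
  · exact (h3 x hx).trans (mul_le_mul_of_nonneg_right ((le_max_right _ _).trans (le_max_right _ _)) (exp_pos _).le)

lemma Nice.sub {f f1 f2 g g1 g2 : ℝ → ℝ} (hf : Nice f f1 f2) (hg : Nice g g1 g2) :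
    Nice (fun x => f x - g x) (fun x => f1 x - g1 x) (fun x => f2 x - g2 x) := by
  refine ⟨fun x => (hf.d1 x).sub (hg.d1 x), fun x => (hf.d2 x).sub (hg.d2 x), hf.c2.sub hg.c2, ?_⟩
  obtain ⟨C, a, ha, h⟩ := hf.bd
  obtain ⟨D, b, hb, h'⟩ := hg.bd
  have hC : 0 ≤ C := by
    have := (abs_nonneg _).trans (h 1 one_pos).1
    exact nonneg_of_mul_nonneg_left this (exp_pos _)
  have hD : 0 ≤ D := by
    have := (abs_nonneg _).trans (h' 1 one_pos).1
    exact nonneg_of_mul_nonneg_left this (exp_pos _)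
  refine ⟨C + D, min a b, lt_min ha hb, fun x hx => ?_⟩
  have e1 : C * exp (-a * x) ≤ C * exp (-(min a b) * x) := by
    refine mul_le_mul_of_nonneg_left (exp_le_exp.2 ?_) hC
    have := mul_le_mul_of_nonneg_right (min_le_left a b) hx.le
    linarith
  have e2 : D * exp (-b * x) ≤ D * exp (-(min a b) * x) := by
    refine mul_le_mul_of_nonneg_left (exp_le_exp.2 ?_) hD
    have := mul_le_mul_of_nonneg_right (min_le_right a b) hx.le
    linarith
  obtain ⟨p1, p2, p3⟩ := h x hx
  obtain ⟨q1, q2, q3⟩ := h' x hx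
  rw [add_mul]
  refine ⟨(abs_sub _ _).trans (by linarith), (abs_sub _ _).trans (by linarith), (abs_sub _ _).trans (by linarith)⟩

lemma Nice.memE2 {f f1 f2 : ℝ → ℝ} (h : Nice f f1 f2) (f0 : f 0 = 0) (f10 : f1 0 = 0) : MemE2 f := by
  have e1 : deriv f = f1 := funext fun x => (h.d1 x).deriv
  have e2 : deriv f1 = f2 := funext fun x => (h.d2 x).deriv
  have cf : Continuous f := continuous_iff_continuousAt.2 fun x => (h.d1 x).continuousAt
  have cf1 : Continuous f1 := continuous_iff_continuousAt.2 fun x => (h.d2 x).continuousAt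
  obtain ⟨C, a, ha, hb⟩ := h.bd
  have lim : Tendsto (fun x => C * exp (-a * x)) atTop (𝓝 0) := by
    have h1 : Tendsto (fun x : ℝ => -a * x) atTop atBot :=
      tendsto_id.const_mul_atTop_of_neg (by linarith)
    simpa using (tendsto_exp_atBot.comp h1).const_mul C
  have sq : ∀ g : ℝ → ℝ, (∀ x, 0 < x → |g x| ≤ C * exp (-a * x)) → Tendsto g atTop (𝓝 0) := by
    intro g hg
    refine squeeze_zero_norm' ?_ lim
    filter_upwards [eventually_gt_atTop 0] with x hx using hg x hx
  unfold MemE2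
  rw [e1, e2]
  refine ⟨fun x _ => h.d1 x, fun x _ => h.d2 x, cf.continuousOn, cf1.continuousOn, h.c2.continuousOn,
    ?_, ?_, ⟨f2 0, ?_⟩, ⟨0, sq f fun x hx => (hb x hx).1⟩, ⟨0, sq f1 fun x hx => (hb x hx).2.1⟩,
    ⟨0, sq f2 fun x hx => (hb x hx).2.2⟩, ⟨2 * C, a, ha, fun x hx => ?_⟩⟩
  · have := cf.tendsto 0
    rw [f0] at this
    exact this.mono_left nhdsWithin_le_nhds
  · have := cf1.tendsto 0
    rw [f10] at this
    exact this.mono_left nhdsWithin_le_nhds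
  · exact (h.c2.tendsto 0).mono_left nhdsWithin_le_nhds
  · have := hb x hx
    linarith [this.2.1, this.2.2]

lemma memE2_sq {s : ℝ} (hs : 0 < s) : MemE2 (fun x => x ^ 2 * exp (-s * x)) := by
  obtain ⟨f2, h⟩ := nice_poly (Polynomial.X ^ 2) hs
  have := h.memE2 (by simp) (by simp)
  simpa using this

lemma memE2_diff {b s : ℝ} (hb : 0 < b) (hs : 0 < s) :
    MemE2 (fun x => x * exp (-b * x) - x * exp (-s * x)) := by
  obtain ⟨f2, h⟩ := nice_poly Polynomial.X hb
  obtain ⟨g2, h'⟩ := nice_poly Polynomial.X hs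
  have := (h.sub h').memE2 (by simp) (by simp)
  simpa using this

lemma riccati {φ g : ℝ → ℝ} {m φ0 t : ℝ} (hm : 0 < m) (ht : 0 ≤ t) (htm : t * m < 1)
    (hφ : ∀ r ∈ Icc 0 t, 0 ≤ φ r) (heq : ∀ r ∈ Icc 0 t, φ r = φ0 + ∫ τ in (0:ℝ)..r, g τ)
    (h0 : φ0 ≤ m) (hg : ∀ r ∈ Icc 0 t, g r ≤ φ r ^ 2) : φ t ≤ m / (1 - t * m) := by
  have h1 : 0 < 1 - t * m := by linarith
  by_cases hi : IntervalIntegrable g volume 0 t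
  swap
  · rw [heq t (right_mem_Icc.2 ht), intervalIntegral.integral_undef hi, add_zero]
    refine h0.trans ?_
    rw [le_div_iff₀ h1]
    have : 0 ≤ t * m := by positivity
    nlinarith
  have hc : ContinuousOn φ (Icc 0 t) := by
    have h1 : ContinuousOn (fun r => φ0 + ∫ τ in (0:ℝ)..r, g τ) (Icc 0 t) := by
      refine continuousOn_const.add ?_
      have := intervalIntegral.continuousOn_primitive_interval' hi left_mem_uIcc
      rwa [uIcc_of_le ht] at this
    exact h1.congr heq
  let ψ : ℝ → ℝ := fun r => φ (max 0 (min r t))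
  have hψ : Continuous ψ := hc.comp_continuous (by fun_prop)
    (fun r => ⟨le_max_left _ _, max_le ht (min_le_right _ _)⟩)
  have hψe : ∀ r ∈ Icc 0 t, ψ r = φ r := by
    intro r hr
    simp only [ψ]
    rw [min_eq_left hr.2, max_eq_right hr.1]
  let R : ℝ → ℝ := fun r => m + ∫ τ in (0:ℝ)..r, ψ τ ^ 2
  have hR : ∀ r, HasDerivAt R (ψ r ^ 2) r := by
    intro r
    exact ((hψ.pow 2).integral_hasStrictDerivAt 0 r).hasDerivAt.const_add m
  have hRm : ∀ r, 0 ≤ r → m ≤ R r := by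
    intro r hr
    have : 0 ≤ ∫ τ in (0:ℝ)..r, ψ τ ^ 2 :=
      intervalIntegral.integral_nonneg hr (fun _ _ => sq_nonneg _)
    simp only [R]; linarith
  have hφR : ∀ r ∈ Icc 0 t, φ r ≤ R r := by
    intro r hr
    rw [heq r hr]
    refine add_le_add h0 ?_
    refine intervalIntegral.integral_mono_on hr.1 ?_ ((hψ.pow 2).intervalIntegrable _ _) ?_
    · refine hi.mono_set ?_
      rw [uIcc_of_le ht, uIcc_of_le hr.1]
      exact Icc_subset_Icc_right hr.2
    · intro τ hτ
      have hτ' : τ ∈ Icc 0 t := ⟨hτ.1, hτ.2.trans hr.2⟩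
      rw [hψe τ hτ']
      exact hg τ hτ'
  have hmono : MonotoneOn (fun r => (R r)⁻¹ + r) (Icc 0 t) := by
    have hd : ∀ r ∈ Icc 0 t, HasDerivAt (fun r => (R r)⁻¹ + r) (-(ψ r ^ 2) / R r ^ 2 + 1) r := by
      intro r hr
      exact ((hR r).inv (by linarith [hRm r hr.1])).add (hasDerivAt_id r)
    refine monotoneOn_of_deriv_nonneg (convex_Icc 0 t) ?_ ?_ ?_
    · exact fun r hr => (hd r hr).continuousAt.continuousWithinAt
    · rw [interior_Icc]
      exact fun r hr => (hd r (Ioo_subset_Icc_self hr)).differentiableAt.differentiableWithinAt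
    · rw [interior_Icc]
      intro r hr
      have hr' := Ioo_subset_Icc_self hr
      rw [(hd r hr').deriv, hψe r hr']
      have hRp : 0 < R r := by linarith [hRm r hr'.1]
      have : φ r ^ 2 / R r ^ 2 ≤ 1 := by
        rw [div_le_one (by positivity)]
        exact pow_le_pow_left₀ (hφ r hr') (hφR r hr') 2
      rw [neg_div]; linarith
  have h2 := hmono (left_mem_Icc.2 ht) (right_mem_Icc.2 ht) ht
  have hR0 : R 0 = m := by simp [R]
  simp only [hR0, add_zero] at h2
  have hRt : 0 < R t := by linarith [hRm t ht]
  refine (hφR t (right_mem_Icc.2 ht)).trans ?_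
  rw [le_div_iff₀ h1]
  have h3 : m⁻¹ * (m * R t) ≤ ((R t)⁻¹ + t) * (m * R t) := mul_le_mul_of_nonneg_right h2 (by positivity)
  have e1 : m⁻¹ * (m * R t) = R t := by field_simp
  have e2 : ((R t)⁻¹ + t) * (m * R t) = m + t * m * R t := by field_simp
  rw [e1, e2] at h3
  linarith

lemma pairing_le_sq {ν : Measure ℝ} {s : ℝ} (hs : 0 < s) (hn : ν (Iic 0) = 0)
    (hi : Integrable (fun x => x ^ 2 * exp (-s * x)) ν)
    (hw : IntegrableOn (fun p : ℝ × ℝ => ((p.1 + p.2) ^ 2 * exp (-s * (p.1 + p.2))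
      - p.1 ^ 2 * exp (-s * p.1) - p.2 ^ 2 * exp (-s * p.2)) * (p.1 * p.2)) (Ioi 0 ×ˢ Ioi 0) (ν.prod ν)) :
    coagPairing (fun x y => x * y) ν (fun x => x ^ 2 * exp (-s * x)) ≤ Lf ν s ^ 2 := by
  have := sfinite_of_integrable hn (by fun_prop) (fun x hx => by positivity) hi
  have hr : (ν.prod ν).restrict (Ioi 0 ×ˢ Ioi 0) = ν.prod ν := by
    rw [← Measure.prod_restrict, restrict_of_null hn]
  have hae : ∀ᵐ p ∂(ν.prod ν), 0 < p.1 ∧ 0 < p.2 := by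
    rw [← hr]
    filter_upwards [ae_restrict_mem (measurableSet_Ioi.prod measurableSet_Ioi)] with p hp using hp
  unfold coagPairing
  rw [IntegrableOn, hr] at hw
  rw [hr]
  have hp : Integrable (fun p : ℝ × ℝ => 2 * ((p.1 ^ 2 * exp (-s * p.1)) * (p.2 ^ 2 * exp (-s * p.2))))
      (ν.prod ν) := (hi.mul_prod hi).const_mul 2
  have h1 : ∫ p : ℝ × ℝ, ((p.1 + p.2) ^ 2 * exp (-s * (p.1 + p.2))
      - p.1 ^ 2 * exp (-s * p.1) - p.2 ^ 2 * exp (-s * p.2)) * (p.1 * p.2) ∂(ν.prod ν) ≤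
      ∫ p : ℝ × ℝ, 2 * ((p.1 ^ 2 * exp (-s * p.1)) * (p.2 ^ 2 * exp (-s * p.2))) ∂(ν.prod ν) := by
    refine integral_mono_ae hw hp ?_
    filter_upwards [hae] with p ⟨hx, hy⟩
    have e : exp (-s * (p.1 + p.2)) = exp (-s * p.1) * exp (-s * p.2) := by
      rw [← exp_add]; congr 1; ring
    rw [e]
    have a0 := exp_pos (-s * p.1)
    have b0 := exp_pos (-s * p.2)
    have a1 : exp (-s * p.1) ≤ 1 := exp_le_one_iff.2 (by nlinarith)
    have b1 : exp (-s * p.2) ≤ 1 := exp_le_one_iff.2 (by nlinarith)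
    generalize exp (-s * p.1) = a at *
    generalize exp (-s * p.2) = b at *
    have k : 0 ≤ (p.1 * p.2) * (p.1 ^ 2 * a * (1 - b) + p.2 ^ 2 * b * (1 - a)) := by
      have := sub_nonneg.2 a1
      have := sub_nonneg.2 b1
      positivity
    nlinarith
  have h2 : ∫ p : ℝ × ℝ, 2 * ((p.1 ^ 2 * exp (-s * p.1)) * (p.2 ^ 2 * exp (-s * p.2))) ∂(ν.prod ν)
      = 2 * Lf ν s ^ 2 := by
    rw [integral_const_mul, integral_prod_mul (fun x => x ^ 2 * exp (-s * x)) (fun x => x ^ 2 * exp (-s * x)), sq]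
    rfl
  rw [h2] at h1
  linarith

lemma good_of_Lf_le {ν : Measure ℝ} (hn : ν (Iic 0) = 0) {C : ℝ} (hC : 0 ≤ C)
    (hi : ∀ s, 0 < s → Integrable (fun x => x ^ 2 * exp (-s * x)) ν)
    (hb : ∀ s, 0 < s → Lf ν s ≤ C) : GoodM ν ∧ M2 ν ≤ C := by
  let f : ℕ → ℝ → ENNReal := fun n x => ENNReal.ofReal (x ^ 2 * exp (-(1 / ((n:ℝ) + 1)) * x))
  have hf : ∀ n, Measurable (f n) := fun n => by fun_prop
  have hlim : ∀ x : ℝ, Tendsto (fun n => f n x) atTop (𝓝 (ENNReal.ofReal (x ^ 2))) := by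
    intro x
    refine ENNReal.tendsto_ofReal ?_
    have h1 := ((tendsto_one_div_add_atTop_nhds_zero_nat (𝕜 := ℝ)).neg.mul_const x)
    have h2 := ((continuous_exp.tendsto _).comp h1).const_mul (x ^ 2)
    simpa using h2
  have h2 : ∫⁻ x, ENNReal.ofReal (x ^ 2) ∂ν ≤ ENNReal.ofReal C := by
    calc ∫⁻ x, ENNReal.ofReal (x ^ 2) ∂ν = ∫⁻ x, liminf (fun n => f n x) atTop ∂ν := by
          congr 1; ext x; exact (hlim x).liminf_eq.symm
      _ ≤ liminf (fun n => ∫⁻ x, f n x ∂ν) atTop := lintegral_liminf_le hf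
      _ ≤ ENNReal.ofReal C := by
          refine liminf_le_of_le (by isBoundedDefault) fun b hb' => ?_
          obtain ⟨n, hn'⟩ := hb'.exists
          refine hn'.trans ?_
          have hp : (0:ℝ) < 1 / ((n:ℝ) + 1) := by positivity
          rw [← ofReal_integral_eq_lintegral_ofReal (hi _ hp) (by filter_upwards with x; positivity)]
          exact ENNReal.ofReal_le_ofReal (hb _ hp)
  have hgood : GoodM ν := by
    refine ⟨hn, by fun_prop, ?_⟩
    rw [hasFiniteIntegral_iff_ofReal (by filter_upwards with x; positivity)]
    exact h2.trans_lt ENNReal.ofReal_lt_top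
  refine ⟨hgood, ?_⟩
  rw [← ofReal_integral_eq_lintegral_ofReal hgood.2 (by filter_upwards with x; positivity)] at h2
  exact (ENNReal.ofReal_le_ofReal_iff hC).1 h2

theorem sol_good {ν₀ : Measure ℝ} {ν : ℝ → Measure ℝ} {T : ℝ} (h0 : GoodM ν₀) (hM : 0 < M2 ν₀)
    (hT : T = (M2 ν₀)⁻¹) (hsol : IsCoagSolutionMult ν₀ T ν) {t : ℝ} (ht : t ∈ Ico 0 T) :
    GoodM (ν t) ∧ M2 (ν t) ≤ M2 ν₀ / (1 - t * M2 ν₀) := by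
  obtain ⟨hn, -, -, h4⟩ := hsol
  have htm : t * M2 ν₀ < 1 := by
    have := mul_lt_mul_of_pos_right ht.2 hM
    rwa [hT, inv_mul_cancel₀ hM.ne'] at this
  have hsub : ∀ r ∈ Icc 0 t, r ∈ Ico 0 T := fun r hr => ⟨hr.1, hr.2.trans_lt ht.2⟩
  have hi : ∀ r ∈ Ico 0 T, ∀ s, 0 < s → Integrable (fun x => x ^ 2 * exp (-s * x)) (ν r) := by
    intro r hr s hs
    have := (h4 _ (memE2_sq hs) r hr).2.1
    rwa [IntegrableOn, restrict_of_null (hn r hr)] at this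
  refine good_of_Lf_le (hn t ht) (div_nonneg hM.le (by linarith)) (hi t ht) fun s hs => ?_
  refine riccati (φ := fun r => Lf (ν r) s) (φ0 := Lf ν₀ s) hM ht.1 htm
    (g := fun r => coagPairing (fun x y => x * y) (ν r) (fun x => x ^ 2 * exp (-s * x)))
    (fun r hr => integral_nonneg fun x => by positivity) (fun r hr => ?_) (h0.Lf_le hs.le) (fun r hr => ?_)
  · have := (h4 _ (memE2_sq hs) r (hsub r hr)).2.2.2
    rwa [restrict_of_null (hn r (hsub r hr)), restrict_of_null h0.1] at this
  · exact pairing_le_sq hs (hn r (hsub r hr)) (hi r (hsub r hr) s hs)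
      ((h4 _ (memE2_sq hs) r (hsub r hr)).1 r ⟨hr.1, le_rfl⟩)

lemma meas_of_compact {ν : ℝ → Measure ℝ} (hG : ∀ t, GoodM (ν t))
    (hm : ∀ B : Set ℝ, IsCompact B → B ⊆ Ioi 0 → Measurable fun t => ((ν t) B).toReal) : Measurable ν := by
  let K : ℕ → Set ℝ := fun n => Icc (1 / ((n:ℝ) + 1)) ((n:ℝ) + 1)
  have hpos : ∀ n : ℕ, (0:ℝ) < 1 / ((n:ℝ) + 1) := fun n => by positivity
  have hfin : ∀ n t, ν t (K n) < ⊤ := by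
    intro n t
    refine lt_of_le_of_lt (measure_mono ?_)
      ((hG t).2.measure_norm_ge_lt_top (ε := (1 / ((n:ℝ) + 1)) ^ 2) (by positivity))
    intro x hx
    have := pow_le_pow_left₀ (hpos n).le hx.1 2
    simpa using this
  have hmK : ∀ n, Measurable fun t => (ν t).restrict (K n) := by
    intro n
    have hfm : ∀ t, IsFiniteMeasure ((ν t).restrict (K n)) :=
      fun t => ⟨by rw [Measure.restrict_apply_univ]; exact hfin n t⟩
    have hcl : ∀ F : Set ℝ, IsClosed F → Measurable fun t => (ν t).restrict (K n) F := by
      intro F hF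
      have h1 := hm (F ∩ K n) (isCompact_Icc.inter_left hF)
        (fun x hx => (hpos n).trans_le hx.2.1)
      have e : (fun t => (ν t).restrict (K n) F) = fun t => ENNReal.ofReal ((ν t (F ∩ K n)).toReal) := by
        ext t
        rw [Measure.restrict_apply hF.measurableSet, ENNReal.ofReal_toReal]
        exact ((measure_mono inter_subset_right).trans_lt (hfin n t)).ne
      rw [e]
      exact h1.ennreal_ofReal
    refine Measurable.measure_of_isPiSystem ((BorelSpace.measurable_eq (α := ℝ)).trans
      borel_eq_generateFrom_isClosed) isPiSystem_isClosed (fun F hF => hcl F hF) (hcl _ isClosed_univ)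
  refine Measure.measurable_of_measurable_coe _ fun s hs => ?_
  have hKm : Monotone K := by
    intro a b hab
    have : (a:ℝ) ≤ b := by exact_mod_cast hab
    refine Icc_subset_Icc ?_ (by linarith)
    exact one_div_le_one_div_of_le (by positivity) (by linarith)
  have hKU : ∀ x : ℝ, 0 < x → ∃ n, x ∈ K n := by
    intro x hx
    obtain ⟨n, hn⟩ := exists_nat_ge (max x (1 / x))
    refine ⟨n, ?_, ?_⟩
    · rw [div_le_iff₀ (by positivity)]
      have := (le_max_right _ _).trans hn
      rw [div_le_iff₀ hx] at this
      nlinarith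
    · linarith [(le_max_left _ _).trans hn]
  have e : (fun t => ν t s) = fun t => ⨆ n, (ν t).restrict (K n) s := by
    ext t
    have h1 : ν t s = ν t (⋃ n, s ∩ K n) := by
      refine measure_congr ?_
      filter_upwards [(hG t).ae_pos] with x hx
      refine propext ⟨fun h => ?_, fun h => ?_⟩
      · obtain ⟨n, hn⟩ := hKU x hx
        exact mem_iUnion.2 ⟨n, h, hn⟩
      · obtain ⟨n, hn⟩ := mem_iUnion.1 h
        exact hn.1
    rw [h1, Monotone.measure_iUnion (fun a b hab => inter_subset_inter_right _ (hKm hab))]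
    refine iSup_congr fun n => ?_
    rw [Measure.restrict_apply hs]
  rw [e]
  exact Measurable.iSup fun n => (Measure.measurable_coe hs).comp (hmK n)

lemma meas_integral {ν : ℝ → Measure ℝ} (hG : ∀ t, GoodM (ν t)) (hν : Measurable ν) {g : ℝ → ℝ}
    (hg : Measurable g) (h0 : ∀ x, 0 < x → 0 ≤ g x) : Measurable fun t => ∫ x, g x ∂(ν t) := by
  have e : (fun t => ∫ x, g x ∂(ν t)) = fun t => (∫⁻ x, ENNReal.ofReal (g x) ∂(ν t)).toReal := by
    ext t
    rw [integral_eq_lintegral_of_nonneg_ae ?_ hg.aestronglyMeasurable]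
    filter_upwards [(hG t).ae_pos] with x hx using h0 x hx
  rw [e]
  exact ((Measure.measurable_lintegral hg.ennreal_ofReal).comp hν).ennreal_toReal

lemma goodM_zero : GoodM (0 : Measure ℝ) := ⟨by simp, by simp⟩

lemma pair_diff {ν : Measure ℝ} (h : GoodM ν) {b s : ℝ} (hb : 0 < b) (hs : 0 < s) :
    coagPairing (fun x y => x * y) ν (fun x => x * exp (-b * x) - x * exp (-s * x))
      = LU ν s * Lf ν s - LU ν b * Lf ν b := by
  have := h.sfinite
  have key : ∀ c, 0 < c → Integrable (Wf (fun x => x * exp (-c * x))) (ν.prod ν) ∧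
      ∫ p, Wf (fun x => x * exp (-c * x)) p ∂(ν.prod ν) = - (2 * (LU ν c * Lf ν c)) := by
    intro c hc
    have e : Wf (fun x => x * exp (-c * x)) = fun p =>
        -((p.1 ^ 2 * exp (-c * p.1)) * (p.2 * (1 - exp (-c * p.2))) +
          (p.1 * (1 - exp (-c * p.1))) * (p.2 ^ 2 * exp (-c * p.2))) := by
      ext p
      have e : exp (-c * (p.1 + p.2)) = exp (-c * p.1) * exp (-c * p.2) := by
        rw [← exp_add]; congr 1; ring
      simp only [Wf]
      rw [e]; ring
    have i1 := (h.intf hc.le).mul_prod (h.intU hc.le)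
    have i2 := (h.intU hc.le).mul_prod (h.intf hc.le)
    rw [e]
    refine ⟨(i1.add i2).neg, ?_⟩
    rw [integral_neg, integral_add i1 i2,
      integral_prod_mul (fun x => x ^ 2 * exp (-c * x)) (fun x => x * (1 - exp (-c * x))),
      integral_prod_mul (fun x => x * (1 - exp (-c * x))) (fun x => x ^ 2 * exp (-c * x))]
    simp only [LU, Lf]
    ring
  have e : Wf (fun x => x * exp (-b * x) - x * exp (-s * x)) = fun p =>
      Wf (fun x => x * exp (-b * x)) p - Wf (fun x => x * exp (-s * x)) p := by
    ext p; simp only [Wf]; ring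
  rw [h.pairing_eq, e, integral_sub (key b hb).1 (key s hs).1, (key b hb).2, (key s hs).2]
  ring

lemma int_diff {ν : Measure ℝ} (h : GoodM ν) {b s : ℝ} (hb : 0 < b) (hs : 0 < s) :
    ∫ x, (x * exp (-b * x) - x * exp (-s * x)) ∂ν = LU ν s - LU ν b := by
  rw [LU, LU, ← integral_sub (h.intU hs.le) (h.intU hb.le)]
  congr 1; ext x; ring

theorem sol_eq {ν₀ : Measure ℝ} {ν : ℝ → Measure ℝ} {T : ℝ} (h0 : GoodM ν₀) (hM : 0 < M2 ν₀)
    (hT : T = (M2 ν₀)⁻¹) (hsol : IsCoagSolutionMult ν₀ T ν) {t : ℝ} (ht : t ∈ Ico 0 T) {s : ℝ} (hs : 0 < s) :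
    IntervalIntegrable (fun τ => LU (ν τ) s * Lf (ν τ) s) volume 0 t ∧
    LU (ν t) s = LU ν₀ s + ∫ τ in (0:ℝ)..t, LU (ν τ) s * Lf (ν τ) s := by
  classical
  have hgood := fun {r : ℝ} (hr : r ∈ Ico 0 T) => sol_good h0 hM hT hsol hr
  obtain ⟨hn, h2, -, h4⟩ := hsol
  have hTm : ∀ r ∈ Ico 0 T, r * M2 ν₀ < 1 := by
    intro r hr
    have := mul_lt_mul_of_pos_right hr.2 hM
    rwa [hT, inv_mul_cancel₀ hM.ne'] at this
  set B := M2 ν₀ / (1 - t * M2 ν₀) with hBdef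
  have hB0 : 0 ≤ B := div_nonneg hM.le (by linarith [hTm t ht])
  have hsub : ∀ r ∈ Icc 0 t, r ∈ Ico 0 T := fun r hr => ⟨hr.1, hr.2.trans_lt ht.2⟩
  have hB : ∀ r ∈ Icc 0 t, M2 (ν r) ≤ B := by
    intro r hr
    refine (hgood (hsub r hr)).2.trans ?_
    refine div_le_div_of_nonneg_left hM.le (by linarith [hTm t ht]) ?_
    have := mul_le_mul_of_nonneg_right hr.2 hM.le
    linarith
  let μ : ℝ → Measure ℝ := fun r => if r ∈ Ico 0 T then ν r else 0
  have hμG : ∀ r, GoodM (μ r) := by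
    intro r
    by_cases hr : r ∈ Ico 0 T
    · simp only [μ, if_pos hr]; exact (hgood hr).1
    · simp only [μ, if_neg hr]; exact goodM_zero
  have hμm : Measurable μ := by
    refine meas_of_compact hμG fun K hK hK0 => ?_
    have e : (fun r => ((μ r) K).toReal) = (Ico 0 T).indicator (fun r => ((ν r) K).toReal) := by
      ext r
      by_cases hr : r ∈ Ico 0 T
      · simp only [μ, if_pos hr, indicator_of_mem hr]
      · simp only [μ, if_neg hr, indicator_of_notMem hr]; simp
    rw [e]
    exact (h2 K hK hK0).indicator measurableSet_Ico
  have hμν : ∀ r ∈ Icc 0 t, μ r = ν r := fun r hr => by simp only [μ, if_pos (hsub r hr)]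
  have hbd : ∀ b, 0 < b → ∀ r ∈ Icc 0 t, |LU (ν r) b * Lf (ν r) b| ≤ b * B * B := by
    intro b hb r hr
    have hg := (hgood (hsub r hr)).1
    rw [abs_of_nonneg (mul_nonneg (hg.LU_nonneg hb.le) (GoodM.Lf_nonneg b))]
    refine mul_le_mul ((hg.LU_le hb.le).trans ?_) ((hg.Lf_le hb.le).trans (hB r hr)) (GoodM.Lf_nonneg b) (by positivity)
    exact mul_le_mul_of_nonneg_left (hB r hr) hb.le
  have hIntg : ∀ b, 0 < b → IntervalIntegrable (fun τ => LU (ν τ) b * Lf (ν τ) b) volume 0 t := by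
    intro b hb
    rw [intervalIntegrable_iff_integrableOn_Ioc_of_le ht.1]
    have hm : Measurable (fun τ => LU (μ τ) b * Lf (μ τ) b) := by
      refine (meas_integral hμG hμm (by fun_prop) fun x hx => ?_).mul
        (meas_integral hμG hμm (by fun_prop) fun x hx => by positivity)
      have : exp (-b * x) ≤ 1 := exp_le_one_iff.2 (by nlinarith)
      exact mul_nonneg hx.le (by linarith)
    refine IntegrableOn.congr_fun (f := fun τ => LU (μ τ) b * Lf (μ τ) b) ?_ (fun r hr => ?_) measurableSet_Ioc
    · refine Measure.integrableOn_of_bounded (M := b * B * B) (by simp) hm.aestronglyMeasurable ?_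
      filter_upwards [ae_restrict_mem measurableSet_Ioc] with r hr
      have hr' := Ioc_subset_Icc_self hr
      rw [hμν r hr']
      exact hbd b hb r hr'
    · simp only [hμν r (Ioc_subset_Icc_self hr)]
  refine ⟨hIntg s hs, ?_⟩
  have main : ∀ b, 0 < b → |LU (ν t) s - (LU ν₀ s + ∫ τ in (0:ℝ)..t, LU (ν τ) s * Lf (ν τ) s)| ≤
      b * (B + M2 ν₀ + t * (B * B)) := by
    intro b hb
    have h := (h4 _ (memE2_diff hb hs) t ht).2.2.2
    rw [restrict_of_null (hn t ht), restrict_of_null h0.1, int_diff (hgood ht).1 hb hs, int_diff h0 hb hs] at h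
    have e : ∫ τ in (0:ℝ)..t, coagPairing (fun x y => x * y) (ν τ) (fun x => x * exp (-b * x) - x * exp (-s * x))
        = (∫ τ in (0:ℝ)..t, LU (ν τ) s * Lf (ν τ) s) - ∫ τ in (0:ℝ)..t, LU (ν τ) b * Lf (ν τ) b := by
      rw [← intervalIntegral.integral_sub (hIntg s hs) (hIntg b hb)]
      refine intervalIntegral.integral_congr fun r hr => ?_
      rw [uIcc_of_le ht.1] at hr
      exact pair_diff (hgood (hsub r hr)).1 hb hs
    rw [e] at h
    have k1 : |∫ τ in (0:ℝ)..t, LU (ν τ) b * Lf (ν τ) b| ≤ b * B * B * t := by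
      have := intervalIntegral.norm_integral_le_of_norm_le_const (a := 0) (b := t) (C := b * B * B)
        (f := fun τ => LU (ν τ) b * Lf (ν τ) b) (fun r hr => by
          rw [uIoc_of_le ht.1] at hr
          exact hbd b hb r (Ioc_subset_Icc_self hr))
      rwa [sub_zero, abs_of_nonneg ht.1] at this
    have k2 := (hgood ht).1.LU_le hb.le
    have k3 := (hgood ht).1.LU_nonneg hb.le
    have k4 := h0.LU_le hb.le
    have k5 := h0.LU_nonneg hb.le
    have k6 := mul_le_mul_of_nonneg_left (hB t (right_mem_Icc.2 ht.1)) hb.le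
    have k7 : 0 ≤ b * M2 ν₀ := by positivity
    have k8 : 0 ≤ b * B := by positivity
    rw [abs_le] at k1 ⊢
    constructor <;> nlinarith
  have hD : 0 ≤ B + M2 ν₀ + t * (B * B) := by have := ht.1; positivity
  have hz : |LU (ν t) s - (LU ν₀ s + ∫ τ in (0:ℝ)..t, LU (ν τ) s * Lf (ν τ) s)| ≤ 0 := by
    refine le_of_forall_pos_le_add fun ε hε => ?_
    have := main (ε / (B + M2 ν₀ + t * (B * B) + 1)) (by positivity)
    refine this.trans ?_
    rw [zero_add, div_mul_eq_mul_div, div_le_iff₀ (by linarith)]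
    nlinarith
  have := abs_eq_zero.1 (le_antisymm hz (abs_nonneg _))
  linarith

theorem sol_LU {ν₀ : Measure ℝ} {ν : ℝ → Measure ℝ} {T : ℝ} (h0 : GoodM ν₀) (hM : 0 < M2 ν₀)
    (hT : T = (M2 ν₀)⁻¹) (hsol : IsCoagSolutionMult ν₀ T ν) {t : ℝ} (ht : t ∈ Ico 0 T) {s : ℝ} (hs : 0 < s) :
    LU (ν t) s = Qu ν₀ t s := by
  have hTm : ∀ r ∈ Ico 0 T, r * M2 ν₀ < 1 := by
    intro r hr
    have := mul_lt_mul_of_pos_right hr.2 hM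
    rwa [hT, inv_mul_cancel₀ hM.ne'] at this
  have hsub : ∀ r ∈ Icc 0 t, r ∈ Ico 0 T := fun r hr => ⟨hr.1, hr.2.trans_lt ht.2⟩
  have hG : ∀ r ∈ Icc 0 t, GoodM (ν r) := fun r hr => (sol_good h0 hM hT hsol (hsub r hr)).1
  set B := M2 ν₀ / (1 - t * M2 ν₀) with hBdef
  have hB0 : 0 ≤ B := div_nonneg hM.le (by linarith [hTm t ht])
  have hB : ∀ r ∈ Icc 0 t, M2 (ν r) ≤ B := by
    intro r hr
    refine (sol_good h0 hM hT hsol (hsub r hr)).2.trans ?_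
    refine div_le_div_of_nonneg_left hM.le (by linarith [hTm t ht]) ?_
    have := mul_le_mul_of_nonneg_right hr.2 hM.le
    linarith
  obtain ⟨h1, h2⟩ := h0.sig_spec ht.1 (hTm t ht) hs.le
  have e : Sig ν₀ t s - t * Qu ν₀ t s = s := h2
  have := char_unique (U := fun r σ => LU (ν r) σ) (F := fun r σ => Lf (ν r) σ) (U0 := LU ν₀)
    (s0 := Sig ν₀ t s) (p := Qu ν₀ t s) ht.1 hB0
    (fun r hr σ hσ => (hG r hr).hasDeriv_LU hσ)
    (fun r hr σ hσ => ⟨GoodM.Lf_nonneg σ, ((hG r hr).Lf_le hσ.le).trans (hB r hr)⟩)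
    (fun r hr c a b hc ha hb => ((hG r hr).Lf_lip hc ha hb).trans
      (mul_le_mul_of_nonneg_left (hB r hr) (by positivity)))
    (fun r hr σ hσ => (sol_eq h0 hM hT hsol (hsub r hr) hσ).2)
    (fun σ hσ => (sol_eq h0 hM hT hsol ht hσ).1)
    (h0.LU_nonneg (hs.le.trans h1)) rfl (by rw [e]; exact hs)
  rw [e] at this
  exact this

lemma secondMoment_eq {ν : Measure ℝ} (h : GoodM ν) : secondMoment ν = ENNReal.ofReal (M2 ν) := by
  unfold secondMoment
  rw [restrict_of_null h.1, M2, ofReal_integral_eq_lintegral_ofReal h.2 (by filter_upwards with x; positivity)]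

lemma secondMoment_toReal {ν : Measure ℝ} (h : GoodM ν) : (secondMoment ν).toReal = M2 ν := by
  rw [secondMoment_eq h, ENNReal.toReal_ofReal GoodM.M2_nonneg]

lemma good_init {ν : Measure ℝ} (hn : ν (Iic 0) = 0) (h : secondMoment ν < ⊤) : GoodM ν := by
  refine ⟨hn, by fun_prop, ?_⟩
  rw [hasFiniteIntegral_iff_ofReal (by filter_upwards with x; positivity)]
  unfold secondMoment at h
  rwa [restrict_of_null hn] at h

theorem flow_solution {ν₀ : Measure ℝ} (h0 : GoodM ν₀) (hM : 0 < M2 ν₀) :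
    ∃ ν : ℝ → Measure ℝ, IsCoagSolutionMult ν₀ (M2 ν₀)⁻¹ ν ∧
      ∀ t ∈ Ico 0 (M2 ν₀)⁻¹, GoodM (ν t) ∧ ∀ s, 0 < s → LU (ν t) s = Qu ν₀ t s := by
  classical
  set T := (M2 ν₀)⁻¹ with hT
  have hTm : ∀ r ∈ Ico 0 T, r * M2 ν₀ < 1 := by
    intro r hr
    have := mul_lt_mul_of_pos_right hr.2 hM
    rwa [hT, inv_mul_cancel₀ hM.ne'] at this
  have hex : ∀ t, ∃ ρ, GoodM ρ ∧ (t ∈ Ico 0 T → (∀ s, 0 < s → LU ρ s = Qu ν₀ t s) ∧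
      M2 ρ ≤ M2 ν₀ / (1 - t * M2 ν₀)) ∧ (t ∉ Ico 0 T → ρ = 0) := by
    intro t
    by_cases ht : t ∈ Ico 0 T
    · obtain ⟨ρ, h1, h2, h3⟩ := exists_flow h0 ht.1 (hTm t ht)
      exact ⟨ρ, h1, fun _ => ⟨h2, h3⟩, fun h => absurd ht h⟩
    · exact ⟨0, goodM_zero, fun h => absurd h ht, fun _ => rfl⟩
  choose ν hG hν hν0 using hex
  have hmeas : Measurable ν := by
    refine measurable_family hG fun s hs => ?_
    have e : (fun t => LU (ν t) s) = (Ico 0 T).indicator (fun t => Qu ν₀ t s) := by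
      ext t
      by_cases ht : t ∈ Ico 0 T
      · rw [indicator_of_mem ht, (hν t ht).1 s hs]
      · rw [indicator_of_notMem ht, hν0 t ht]; simp [LU]
    rw [e]
    have hc : ContinuousOn (fun t => Qu ν₀ t s) (Ico 0 T) :=
      (h0.contOn_Qu_t hs.le).mono fun t ht => ⟨ht.1, hTm t ht⟩
    have := hc.measurable_piecewise (continuousOn_const (c := (0:ℝ))) measurableSet_Ico
    rw [← piecewise_eq_indicator]
    exact this
  have hM2 : Measurable fun t => M2 (ν t) := meas_integral hG hmeas (by fun_prop) fun x _ => by positivity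
  have hb : ∀ t ∈ Ico 0 T, ∀ r ∈ Icc 0 t, M2 (ν r) ≤ M2 ν₀ / (1 - t * M2 ν₀) := by
    intro t ht r hr
    refine (hν r ⟨hr.1, hr.2.trans_lt ht.2⟩).2.trans ?_
    refine div_le_div_of_nonneg_left hM.le (by linarith [hTm t ht]) ?_
    have := mul_le_mul_of_nonneg_right hr.2 hM.le
    linarith
  refine ⟨ν, ⟨fun t _ => (hG t).1, fun B hB _ => ?_, fun t ht => ?_, fun f hf t ht => ?_⟩,
    fun t ht => ⟨hG t, (hν t ht).1⟩⟩
  · exact ((Measure.measurable_coe hB.measurableSet).comp hmeas).ennreal_toReal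
  · simp only [fun r => secondMoment_toReal (hG r)]
    refine Measure.integrableOn_of_bounded (M := (M2 ν₀ / (1 - t * M2 ν₀)) ^ 2) (by simp)
      (hM2.pow_const 2).aestronglyMeasurable ?_
    filter_upwards [ae_restrict_mem measurableSet_Ioc] with r hr
    rw [Real.norm_eq_abs, abs_of_nonneg (sq_nonneg _)]
    exact pow_le_pow_left₀ GoodM.M2_nonneg (hb t ⟨ht.1.le, ht.2⟩ r (Ioc_subset_Icc_self hr)) 2
  · obtain ⟨A, hA⟩ := hf.qb
    refine ⟨fun τ _ => ?_, ((hG t).int_QB hA).integrableOn, (h0.int_QB hA).integrableOn, ?_⟩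
    · exact ((hG τ).Wf_int hA).integrableOn
    · rw [restrict_of_null (hG t).1, restrict_of_null h0.1]
      exact weak_form h0 hM ht.1 (hTm t ht) (M := M2 ν₀ / (1 - t * M2 ν₀))
        (fun τ hτ => ⟨hG τ, (hν τ ⟨hτ.1, hτ.2.trans_lt ht.2⟩).1, hb t ht τ hτ⟩) hf

theorem multiplicative_kernel_well_posedness
    (ν₀ : Measure ℝ) (hν₀supp : ν₀ (Set.Iic 0) = 0)
    (hm₂ : secondMoment ν₀ < ⊤) :
    ∃ ν : ℝ → Measure ℝ,
      IsCoagSolutionMult ν₀ ((secondMoment ν₀).toReal)⁻¹ ν ∧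
      -- uniqueness: any solution on [0, m₂(0)⁻¹) coincides with it
      (∀ ν' : ℝ → Measure ℝ,
        IsCoagSolutionMult ν₀ ((secondMoment ν₀).toReal)⁻¹ ν' →
        ∀ t : ℝ, t ∈ Set.Ico (0:ℝ) ((secondMoment ν₀).toReal)⁻¹ → ν' t = ν t) := by
  have h0 := good_init hν₀supp hm₂
  rw [secondMoment_toReal h0]
  rcases (GoodM.M2_nonneg (ν := ν₀)).eq_or_lt with hM | hM
  · rw [← hM, inv_zero, Ico_self]
    refine ⟨fun _ => 0, ⟨fun t ht => ?_, fun B _ _ => ?_, fun t ht => ?_, fun f _ t ht => ?_⟩,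
      fun ν' _ t ht => ?_⟩
    · simp
    · simp
    · rw [Ioo_self] at ht; exact absurd ht (notMem_empty t)
    · rw [Ico_self] at ht; exact absurd ht (notMem_empty t)
    · exact absurd ht (notMem_empty t)
  · obtain ⟨ν, hsol, hν⟩ := flow_solution h0 hM
    refine ⟨ν, hsol, fun ν' hsol' t ht => ?_⟩
    refine GoodM.ext_LU (sol_good h0 hM rfl hsol' ht).1 (hν t ht).1 fun s hs => ?_
    rw [sol_LU h0 hM rfl hsol' ht hs, (hν t ht).2 s hs]
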